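/- arXiv:0808.1947 — 5 statements merged into one kernel-verified Lean document; each statement's English description precedes it below -/
import Mathlib

section
/- Let S_1, …, S_n ∈ U be the unique elements of U(g_-) such that cdet(τ + E[−1]) = τ^n + S_1 τ^{n−1} + ⋯ + S_{n−1} τ + S_n in U (powers of τ written on the right). Then each S_l is a Segal–Sugawara vector: for every l = 1, …, n and every basis element e_{ij}[r] with r ≥ 0, the product e_{ij}[r] · S_l lies in (K + n)·U + I, where I is the left ideal of U generated by all e_{ij}[r] with r ≥ 0. -/
open scoped BigOperators

/-- Generators of the Lie algebra `L`: the elements `e_{ij}[r]`, the central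
element `K` and the element `τ`. -/
inductive AffGen (n : ℕ) : Type
  | E : Fin n → Fin n → ℤ → AffGen n
  | K : AffGen n
  | T : AffGen n

/-- The defining relations of the universal enveloping algebra `U(L)`:
`K` is central, `[τ, e_{ij}[r]] = -r e_{ij}[r-1]`, `[τ, K] = 0`, and
`[e_{ij}[r], e_{kl}[s]] = δ_{kj} e_{il}[r+s] - δ_{il} e_{kj}[r+s]
  + r δ_{r,-s} (δ_{kj} δ_{il} - δ_{ij} δ_{kl}/n) K`. -/
inductive AffRel (n : ℕ) :
    FreeAlgebra ℂ (AffGen n) → FreeAlgebra ℂ (AffGen n) → Prop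
  | KE (i j : Fin n) (r : ℤ) :
      AffRel n (FreeAlgebra.ι ℂ (AffGen.K : AffGen n) * FreeAlgebra.ι ℂ (AffGen.E i j r))
            (FreeAlgebra.ι ℂ (AffGen.E i j r) * FreeAlgebra.ι ℂ (AffGen.K : AffGen n))
  | KT :
      AffRel n (FreeAlgebra.ι ℂ (AffGen.K : AffGen n) * FreeAlgebra.ι ℂ (AffGen.T : AffGen n))
            (FreeAlgebra.ι ℂ (AffGen.T : AffGen n) * FreeAlgebra.ι ℂ (AffGen.K : AffGen n))
  | TE (i j : Fin n) (r : ℤ) :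
      AffRel n (FreeAlgebra.ι ℂ (AffGen.T : AffGen n) * FreeAlgebra.ι ℂ (AffGen.E i j r)
              - FreeAlgebra.ι ℂ (AffGen.E i j r) * FreeAlgebra.ι ℂ (AffGen.T : AffGen n))
            ((-r : ℂ) • FreeAlgebra.ι ℂ (AffGen.E i j (r - 1)))
  | EE (i j k l : Fin n) (r s : ℤ) :
      AffRel n (FreeAlgebra.ι ℂ (AffGen.E i j r) * FreeAlgebra.ι ℂ (AffGen.E k l s)
              - FreeAlgebra.ι ℂ (AffGen.E k l s) * FreeAlgebra.ι ℂ (AffGen.E i j r))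
            ((if k = j then FreeAlgebra.ι ℂ (AffGen.E i l (r + s)) else 0)
              - (if i = l then FreeAlgebra.ι ℂ (AffGen.E k j (r + s)) else 0)
              + (((r : ℂ) * (if r = -s then (1 : ℂ) else 0) *
                    ((if k = j then (1 : ℂ) else 0) * (if i = l then (1 : ℂ) else 0)
                      - (if i = j then (1 : ℂ) else 0) * (if k = l then (1 : ℂ) else 0)
                          / (n : ℂ))) •
                  FreeAlgebra.ι ℂ (AffGen.K : AffGen n)))

/-- The universal enveloping algebra `U = U(L)`. -/
abbrev UEA (n : ℕ) : Type := RingQuot (AffRel n)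

/-- The element `e_{ij}[r]` of `U`. -/
noncomputable def eGen (n : ℕ) (i j : Fin n) (r : ℤ) : UEA n :=
  RingQuot.mkAlgHom ℂ (AffRel n) (FreeAlgebra.ι ℂ (AffGen.E i j r))

/-- The central element `K` of `U`. -/
noncomputable def KGen (n : ℕ) : UEA n :=
  RingQuot.mkAlgHom ℂ (AffRel n) (FreeAlgebra.ι ℂ (AffGen.K : AffGen n))

/-- The element `τ` of `U`. -/
noncomputable def tauGen (n : ℕ) : UEA n :=
  RingQuot.mkAlgHom ℂ (AffRel n) (FreeAlgebra.ι ℂ (AffGen.T : AffGen n))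

/-- The column-determinant of a matrix over a (noncommutative) ring:
`cdet A = Σ_σ sgn σ · a_{σ(1)1} a_{σ(2)2} ⋯ a_{σ(n)n}`, factors ordered by
column index. -/
noncomputable def cdet {R : Type*} [Ring R] {n : ℕ} (A : Matrix (Fin n) (Fin n) R) : R :=
  ∑ σ : Equiv.Perm (Fin n),
    (Equiv.Perm.sign σ : ℤ) • (List.ofFn fun j : Fin n => A (σ j) j).prod

/-- The matrix `τ + E[-1]`, with `(i,j)` entry `δ_{ij} τ + e_{ij}[-1]`. -/
noncomputable def tauE (n : ℕ) : Matrix (Fin n) (Fin n) (UEA n) :=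
  Matrix.of fun i j => (if i = j then tauGen n else 0) + eGen n i j (-1)

/-- The subalgebra `U(g₋)` of `U` generated by the `e_{ij}[r]` with `r < 0`. -/
noncomputable def Uneg (n : ℕ) : Subalgebra ℂ (UEA n) :=
  Algebra.adjoin ℂ {x : UEA n | ∃ i j : Fin n, ∃ r : ℤ, r < 0 ∧ x = eGen n i j r}

/-- The left ideal `I` of `U` generated by the `e_{ij}[r]` with `r ≥ 0`. -/
noncomputable def Ipos (n : ℕ) : Submodule (UEA n) (UEA n) :=
  Submodule.span (UEA n)
    {x : UEA n | ∃ i j : Fin n, ∃ r : ℤ, 0 ≤ r ∧ x = eGen n i j r}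

/-- The left submodule `(K + n)·U + I` of `U` (note `K + n` is central,
so `(K+n)·U = U·(K+n)`). -/
noncomputable def KnI (n : ℕ) : Submodule (UEA n) (UEA n) :=
  Submodule.span (UEA n)
    (insert (KGen n + (n : UEA n))
      {x : UEA n | ∃ i j : Fin n, ∃ r : ℤ, 0 ≤ r ∧ x = eGen n i j r})

section Relations

variable {n : ℕ}

theorem KGen_mul_eGen (i j : Fin n) (r : ℤ) :
    KGen n * eGen n i j r = eGen n i j r * KGen n := by
  have h := RingQuot.mkAlgHom_rel ℂ (AffRel.KE i j r)
  rwa [map_mul, map_mul] at h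

theorem KGen_mul_tauGen : KGen n * tauGen n = tauGen n * KGen n := by
  have h := RingQuot.mkAlgHom_rel ℂ (AffRel.KT (n := n))
  rwa [map_mul, map_mul] at h

theorem tauGen_mul_eGen (i j : Fin n) (r : ℤ) :
    tauGen n * eGen n i j r - eGen n i j r * tauGen n = (-r : ℂ) • eGen n i j (r - 1) := by
  have h := RingQuot.mkAlgHom_rel ℂ (AffRel.TE i j r)
  rwa [map_sub, map_mul, map_mul, map_smul] at h

theorem eGen_mul_eGen (i j k l : Fin n) (r s : ℤ) :
    eGen n i j r * eGen n k l s - eGen n k l s * eGen n i j r =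
      (if k = j then eGen n i l (r + s) else 0) - (if i = l then eGen n k j (r + s) else 0)
        + ((r : ℂ) * (if r = -s then (1 : ℂ) else 0) *
            ((if k = j then (1 : ℂ) else 0) * (if i = l then (1 : ℂ) else 0)
              - (if i = j then (1 : ℂ) else 0) * (if k = l then (1 : ℂ) else 0) / (n : ℂ))) •
          KGen n := by
  have h := RingQuot.mkAlgHom_rel ℂ (AffRel.EE i j k l r s)
  simp only [map_sub, map_add, map_mul, map_smul, apply_ite (RingQuot.mkAlgHom ℂ (AffRel n)),
    map_zero] at h
  exact h

/-- In nonnegative degrees the central term of the bracket vanishes. -/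
theorem eGen_mul_eGen_of_nonneg (i j k l : Fin n) {r s : ℤ} (hr : 0 ≤ r) (hs : 0 ≤ s) :
    eGen n i j r * eGen n k l s - eGen n k l s * eGen n i j r =
      (if k = j then eGen n i l (r + s) else 0) - (if i = l then eGen n k j (r + s) else 0) := by
  rw [eGen_mul_eGen]
  have : (r : ℂ) * (if r = -s then (1 : ℂ) else 0) = 0 := by
    split_ifs with h
    · have : r = 0 := by omega
      simp [this]
    · simp
  rw [this, zero_mul, zero_smul, add_zero]

theorem UEA_induction {p : UEA n → Prop} (algebraMap : ∀ c : ℂ, p (algebraMap ℂ (UEA n) c))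
    (eGen : ∀ i j r, p (eGen n i j r)) (KGen : p (KGen n)) (tauGen : p (tauGen n))
    (mul : ∀ x y, p x → p y → p (x * y)) (add : ∀ x y, p x → p y → p (x + y)) (x : UEA n) :
    p x := by
  obtain ⟨y, rfl⟩ := RingQuot.mkAlgHom_surjective ℂ (AffRel n) x
  induction y using FreeAlgebra.induction with
  | grade0 c => rw [AlgHom.commutes]; exact algebraMap c
  | grade1 g =>
    cases g with
    | E i j r => exact eGen i j r
    | K => exact KGen
    | T => exact tauGen
  | mul a b ha hb => rw [map_mul]; exact mul _ _ ha hb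
  | add a b ha hb => rw [map_add]; exact add _ _ ha hb

theorem KGen_mul (x : UEA n) : KGen n * x = x * KGen n := by
  induction x using UEA_induction with
  | algebraMap c => exact (Algebra.commutes c _).symm
  | eGen i j r => exact KGen_mul_eGen i j r
  | KGen => rfl
  | tauGen => exact KGen_mul_tauGen
  | mul x y hx hy => rw [← mul_assoc, hx, mul_assoc, hy, mul_assoc]
  | add x y hx hy => rw [mul_add, add_mul, hx, hy]

end Relations

section VacuumIdeal

variable {n : ℕ}

theorem eGen_mem_KnI (i j : Fin n) {r : ℤ} (hr : 0 ≤ r) : eGen n i j r ∈ KnI n :=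
  Submodule.subset_span (Set.mem_insert_of_mem _ ⟨i, j, r, hr, rfl⟩)

theorem KGen_add_mem_KnI : KGen n + (n : UEA n) ∈ KnI n :=
  Submodule.subset_span (Set.mem_insert _ _)

theorem eGen_mul_tauGen (i j : Fin n) (r : ℤ) :
    eGen n i j r * tauGen n = tauGen n * eGen n i j r + (r : ℂ) • eGen n i j (r - 1) := by
  have h := (tauGen_mul_eGen i j r).trans (neg_smul (r : ℂ) (eGen n i j (r - 1)))
  rw [sub_eq_iff_eq_add] at h
  rw [h]
  abel

/-- The left ideal is stable under right multiplication by `τ`. -/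
theorem mul_tauGen_mem_KnI {x : UEA n} (hx : x ∈ KnI n) : x * tauGen n ∈ KnI n := by
  induction hx using Submodule.span_induction with
  | mem x hx =>
    rcases hx with rfl | ⟨i, j, r, hr, rfl⟩
    · have : (KGen n + (n : UEA n)) * tauGen n = tauGen n • (KGen n + (n : UEA n)) := by
        rw [smul_eq_mul, add_mul, mul_add, KGen_mul, (Nat.cast_commute n (tauGen n)).eq]
      rw [this]
      exact Submodule.smul_mem _ _ KGen_add_mem_KnI
    · rw [eGen_mul_tauGen]
      refine add_mem (Submodule.smul_mem _ (tauGen n) (eGen_mem_KnI i j hr)) ?_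
      rcases hr.eq_or_lt with rfl | hr
      · simp
      · exact Submodule.smul_of_tower_mem _ _ (eGen_mem_KnI i j (by omega))
  | zero => simp
  | add x y _ _ hx hy => rw [add_mul]; exact add_mem hx hy
  | smul a x _ hx => rw [smul_mul_assoc]; exact Submodule.smul_mem _ _ hx

theorem mul_tauGen_pow_mem_KnI {x : UEA n} (hx : x ∈ KnI n) (k : ℕ) :
    x * tauGen n ^ k ∈ KnI n := by
  induction k with
  | zero => simpa
  | succ k ih => rw [pow_succ, ← mul_assoc]; exact mul_tauGen_mem_KnI ih

/-- The trace `∑ i, e_{ii}[r]`. -/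
noncomputable def traceGen (n : ℕ) (r : ℤ) : UEA n := ∑ i, eGen n i i r

theorem traceGen_mul_eGen (k l : Fin n) (r s : ℤ) :
    traceGen n r * eGen n k l s = eGen n k l s * traceGen n r := by
  rw [← sub_eq_zero, traceGen, Finset.sum_mul, Finset.mul_sum, ← Finset.sum_sub_distrib]
  simp_rw [eGen_mul_eGen]
  rw [Finset.sum_add_distrib, ← Finset.sum_smul, ← Finset.mul_sum, Finset.sum_sub_distrib,
    Finset.sum_sub_distrib]
  have hn : (n : ℂ) ≠ 0 := Nat.cast_ne_zero.2 (Fin.pos k).ne'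
  have : (n : ℂ) * ((if k = l then 1 else 0) / n) = if k = l then 1 else 0 := by
    field_simp
  simp [this]

theorem traceGen_mul_tauGen (r : ℤ) :
    traceGen n r * tauGen n = tauGen n * traceGen n r + (r : ℂ) • traceGen n (r - 1) := by
  simp only [traceGen, Finset.sum_mul, Finset.mul_sum, Finset.smul_sum, eGen_mul_tauGen,
    Finset.sum_add_distrib]

theorem traceGen_mul_mem_KnI {r : ℤ} (hr : 0 ≤ r) (x : UEA n) : traceGen n r * x ∈ KnI n := by
  let J : Submodule (UEA n) (UEA n) :=
    Submodule.span (UEA n) {y | ∃ r : ℤ, 0 ≤ r ∧ y = traceGen n r}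
  have htr : ∀ r : ℤ, 0 ≤ r → traceGen n r ∈ J := fun r hr => Submodule.subset_span ⟨r, hr, rfl⟩
  have hJ : ∀ x, (∀ r : ℤ, 0 ≤ r → traceGen n r * x ∈ J) → ∀ y ∈ J, y * x ∈ J := by
    intro x hx y hy
    induction hy using Submodule.span_induction with
    | mem y hy => obtain ⟨r, hr, rfl⟩ := hy; exact hx r hr
    | zero => simp
    | add y z _ _ hy hz => rw [add_mul]; exact add_mem hy hz
    | smul a y _ hy => rw [smul_mul_assoc]; exact Submodule.smul_mem _ _ hy
  have key : ∀ x, ∀ y ∈ J, y * x ∈ J := by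
    intro x
    induction x using UEA_induction with
    | algebraMap c =>
      refine hJ _ fun r hr => ?_
      rw [← Algebra.commutes]
      exact Submodule.smul_mem _ (algebraMap ℂ (UEA n) c) (htr r hr)
    | eGen i j s =>
      refine hJ _ fun r hr => ?_
      rw [traceGen_mul_eGen]
      exact Submodule.smul_mem _ (eGen n i j s) (htr r hr)
    | KGen =>
      refine hJ _ fun r hr => ?_
      rw [← KGen_mul]
      exact Submodule.smul_mem _ (KGen n) (htr r hr)
    | tauGen =>
      refine hJ _ fun r hr => ?_
      rw [traceGen_mul_tauGen]
      refine add_mem (Submodule.smul_mem _ (tauGen n) (htr r hr)) ?_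
      rcases hr.eq_or_lt with rfl | hr
      · simp
      · exact Submodule.smul_of_tower_mem _ _ (htr _ (by omega))
    | mul x y hx hy => intro z hz; rw [← mul_assoc]; exact hy _ (hx _ hz)
    | add x y hx hy => intro z hz; rw [mul_add]; exact add_mem (hx _ hz) (hy _ hz)
  have hle : J ≤ KnI n := by
    refine Submodule.span_le.2 ?_
    rintro _ ⟨r, hr, rfl⟩
    exact sum_mem fun i _ => eGen_mem_KnI i i hr
  exact hle (key x _ (htr r hr))

/-- A vector killed by the off-diagonal `e_{ij}[0]` and `e_{ij}[1]` is killed by all `e_{ij}[r]`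
with `r ≥ 0`. -/
theorem eGen_mul_mem_KnI_of_ne {w : UEA n}
    (h0 : ∀ i j, i ≠ j → eGen n i j 0 * w ∈ KnI n)
    (h1 : ∀ i j, i ≠ j → eGen n i j 1 * w ∈ KnI n) (i j : Fin n) {r : ℤ} (hr : 0 ≤ r) :
    eGen n i j r * w ∈ KnI n := by
  have bracket : ∀ x y : UEA n, x * w ∈ KnI n → y * w ∈ KnI n →
      (x * y - y * x) * w ∈ KnI n := by
    intro x y hx hy
    rw [sub_mul, mul_assoc, mul_assoc]
    exact sub_mem (Submodule.smul_mem _ x hy) (Submodule.smul_mem _ y hx)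
  have diag : ∀ r s : ℤ, 0 ≤ r → 0 ≤ s → (∀ i j, i ≠ j → eGen n i j r * w ∈ KnI n) →
      (∀ i j, i ≠ j → eGen n i j s * w ∈ KnI n) → ∀ i, eGen n i i (r + s) * w ∈ KnI n := by
    intro r s hr hs Hr Hs i
    have hsub : ∀ j, (eGen n i i (r + s) - eGen n j j (r + s)) * w ∈ KnI n := by
      intro j
      by_cases hij : i = j
      · simp [hij]
      · have h := bracket _ _ (Hr i j hij) (Hs j i (Ne.symm hij))
        rwa [eGen_mul_eGen_of_nonneg _ _ _ _ hr hs, if_pos rfl, if_pos rfl] at h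
    have hn : (n : ℂ) ≠ 0 := Nat.cast_ne_zero.2 (Fin.pos i).ne'
    have hsum : eGen n i i (r + s) * w = (n : ℂ)⁻¹ • (traceGen n (r + s) * w +
        ∑ j, (eGen n i i (r + s) - eGen n j j (r + s)) * w) := by
      rw [← Finset.sum_mul, ← add_mul, Finset.sum_sub_distrib, traceGen, add_sub_cancel,
        Finset.sum_const, Finset.card_univ, Fintype.card_fin, ← Nat.cast_smul_eq_nsmul ℂ,
        smul_mul_assoc, inv_smul_smul₀ hn]
    rw [hsum]
    exact Submodule.smul_of_tower_mem _ _
      (add_mem (traceGen_mul_mem_KnI (by omega) w) (sum_mem fun j _ => hsub j))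
  have off : ∀ m : ℕ, ∀ i j, i ≠ j → eGen n i j m * w ∈ KnI n := by
    intro m
    induction m with
    | zero => simpa using h0
    | succ m ih =>
      intro i j hij
      have hd := diag 0 1 le_rfl zero_le_one h0 h1 i
      have h := bracket _ _ hd (ih i j hij)
      rw [eGen_mul_eGen_of_nonneg _ _ _ _ (by norm_num) (by omega), if_pos rfl, if_neg hij,
        sub_zero] at h
      have e : (0 + 1 + (m : ℤ)) = ((m + 1 : ℕ) : ℤ) := by push_cast; ring
      rwa [e] at h
  lift r to ℕ using hr
  by_cases hij : i = j
  · subst hij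
    simpa using diag 0 r le_rfl (by omega) h0 (off r) i
  · exact off r i j hij

end VacuumIdeal

section Coefficients

open Polynomial

variable {n : ℕ}

/-- The homomorphism `U → U[X]` fixing `e_{ij}[r]` and `K` and sending `τ` to `τ + X`. -/
noncomputable def tauShift (n : ℕ) : UEA n →ₐ[ℂ] (UEA n)[X] :=
  RingQuot.liftAlgHom ℂ ⟨FreeAlgebra.lift ℂ fun g => match g with
    | AffGen.E i j r => C (eGen n i j r)
    | AffGen.K => C (KGen n)
    | AffGen.T => X + C (tauGen n), by
    intro x y h
    cases h with
    | KE i j r =>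
      simp only [map_mul, FreeAlgebra.lift_ι_apply]
      simp only [← C_mul, KGen_mul]
    | KT =>
      simp only [map_mul, FreeAlgebra.lift_ι_apply]
      simp only [mul_add, add_mul, ← C_mul, KGen_mul, X_mul_C]
    | TE i j r =>
      simp only [map_mul, map_sub, map_smul, FreeAlgebra.lift_ι_apply]
      simp only [mul_add, add_mul, ← C_mul, X_mul_C, smul_C]
      rw [← tauGen_mul_eGen, C_sub]
      abel
    | EE i j k l r s =>
      simp only [map_mul, map_sub, map_add, map_smul, FreeAlgebra.lift_ι_apply,
        apply_ite (FreeAlgebra.lift ℂ _), map_zero]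
      simp only [← C_mul, ← C_sub, eGen_mul_eGen]
      simp only [smul_C, C_add, C_sub, apply_ite C, C_0]⟩

theorem tauShift_eGen (i j : Fin n) (r : ℤ) : tauShift n (eGen n i j r) = C (eGen n i j r) := by
  simp [tauShift, eGen]

theorem tauShift_KGen : tauShift n (KGen n) = C (KGen n) := by
  simp [tauShift, KGen]

theorem tauShift_tauGen : tauShift n (tauGen n) = X + C (tauGen n) := by
  simp [tauShift, tauGen]

theorem tauShift_of_mem_Uneg {x : UEA n} (hx : x ∈ Uneg n) : tauShift n x = C x := by
  have h : Uneg n ≤ AlgHom.equalizer (tauShift n) (CAlgHom (R := ℂ) (A := UEA n)) := by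
    refine Algebra.adjoin_le ?_
    rintro _ ⟨i, j, r, -, rfl⟩
    exact tauShift_eGen i j r
  exact h hx

theorem coeff_mul_mem_of_coeff_mem {R : Type*} [Ring R] (J : Submodule R R) (p : R[X]) {q : R[X]}
    (hq : ∀ k, q.coeff k ∈ J) (k : ℕ) : (p * q).coeff k ∈ J := by
  rw [coeff_mul]
  exact sum_mem fun a _ => Submodule.smul_mem _ (p.coeff a.1) (hq a.2)

theorem coeff_tauShift_mem_KnI {x : UEA n} (hx : x ∈ KnI n) (k : ℕ) :
    (tauShift n x).coeff k ∈ KnI n := by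
  have coeff_C_mem : ∀ {y : UEA n}, y ∈ KnI n → ∀ k, (C y).coeff k ∈ KnI n := by
    intro y hy k
    rw [coeff_C]
    split_ifs
    exacts [hy, zero_mem _]
  induction hx using Submodule.span_induction generalizing k with
  | mem x hx =>
    rcases hx with rfl | ⟨i, j, r, hr, rfl⟩
    · rw [map_add, tauShift_KGen, map_natCast, ← C_eq_natCast, ← C_add]
      exact coeff_C_mem KGen_add_mem_KnI k
    · rw [tauShift_eGen]
      exact coeff_C_mem (eGen_mem_KnI i j hr) k
  | zero => simp
  | add x y _ _ hx hy => rw [map_add, coeff_add]; exact add_mem (hx k) (hy k)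
  | smul a x _ hx =>
    rw [smul_eq_mul, map_mul]
    exact coeff_mul_mem_of_coeff_mem _ _ hx k

/-- If `u` and the coefficients `T m` do not involve `τ` and `u * ∑ T m τ^{N-m}` lies in the left
ideal, then so does every `u * T l`. -/
theorem mul_coeff_mem_KnI {u : UEA n} (hu : tauShift n u = C u) (N : ℕ) (T : ℕ → UEA n)
    (hT : ∀ m ≤ N, tauShift n (T m) = C (T m))
    (h : u * ∑ m ∈ Finset.range (N + 1), T m * tauGen n ^ (N - m) ∈ KnI n) (l : ℕ) (hl : l ≤ N) :
    u * T l ∈ KnI n := by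
  induction l using Nat.strong_induction_on with
  | _ l ih =>
    have hc := coeff_tauShift_mem_KnI h (N - l)
    have e : (tauShift n (u * ∑ m ∈ Finset.range (N + 1), T m * tauGen n ^ (N - m))).coeff (N - l)
        = ∑ m ∈ Finset.range (N + 1),
          u * T m * (tauGen n ^ (N - m - (N - l)) * ((N - m).choose (N - l) : UEA n)) := by
      rw [map_mul, hu, map_sum, Finset.mul_sum, finsetSum_coeff]
      refine Finset.sum_congr rfl fun m hm => ?_
      rw [map_mul, hT m (by simpa [Nat.lt_succ_iff] using hm), map_pow, tauShift_tauGen,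
        ← mul_assoc, ← C_mul, coeff_C_mul, coeff_X_add_C_pow]
    rw [e, ← Finset.add_sum_erase _ _ (Finset.mem_range.2 (Nat.lt_succ_of_le hl))] at hc
    rw [Nat.sub_self, Nat.choose_self, pow_zero, Nat.cast_one, mul_one, mul_one] at hc
    refine (Submodule.add_mem_iff_left _ (sum_mem fun m hm => ?_)).1 hc
    rw [Finset.mem_erase, Finset.mem_range] at hm
    rcases lt_or_gt_of_ne hm.1 with hml | hml
    · rw [← (Nat.cast_commute _ _).eq, ← mul_assoc, ← (Nat.cast_commute _ (u * T m)).eq, mul_assoc]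
      exact Submodule.smul_mem _ (_ : UEA n)
        (mul_tauGen_pow_mem_KnI (ih m hml (by omega)) _)
    · rw [Nat.choose_eq_zero_of_lt (by omega)]
      simp

end Coefficients

section Anticommuting

variable {ι B : Type*} [Ring B]

theorem mul_list_prod_of_anticomm {ψ : ι → B} {x : B} (hx : ∀ c, x * ψ c = -(ψ c * x))
    (L : List ι) : x * (L.map ψ).prod = (-1) ^ L.length * ((L.map ψ).prod * x) := by
  induction L with
  | nil => simp
  | cons c L ih =>
    rw [List.map_cons, List.prod_cons, ← mul_assoc, hx, neg_mul, mul_assoc, ih, List.length_cons,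
      pow_succ]
    rcases neg_one_pow_eq_or B L.length with h | h <;> simp [h, mul_assoc]

theorem mul_list_prod_mul_swap {ψ : ι → B} {x y : B} (hx : ∀ c, x * ψ c = -(ψ c * x))
    (hy : ∀ c, y * ψ c = -(ψ c * y)) (hxy : x * y = -(y * x)) (L : List ι) :
    x * (L.map ψ).prod * y = -(y * (L.map ψ).prod * x) := by
  rw [mul_list_prod_of_anticomm hx, mul_list_prod_of_anticomm hy, mul_assoc, mul_assoc, mul_assoc,
    mul_assoc, hxy, mul_neg, mul_neg]

theorem mul_list_prod_mul_self {ψ : ι → B} {x : B} (hx : ∀ c, x * ψ c = -(ψ c * x))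
    (hxx : x * x = 0) (L : List ι) : x * (L.map ψ).prod * x = 0 := by
  rw [mul_list_prod_of_anticomm hx, mul_assoc, mul_assoc, hxx, mul_zero, mul_zero]

theorem list_prod_mul_of_mem {ψ : ι → B} (anti : ∀ c d, ψ c * ψ d = -(ψ d * ψ c))
    (sq : ∀ c, ψ c * ψ c = 0) {j : ι} {L : List ι} (hj : j ∈ L) : (L.map ψ).prod * ψ j = 0 := by
  induction L with
  | nil => simp at hj
  | cons c L ih =>
    rw [List.map_cons, List.prod_cons]
    rcases List.mem_cons.1 hj with rfl | hj
    · exact mul_list_prod_mul_self (anti j) (sq j) L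
    · rw [mul_assoc, ih hj, mul_zero]

theorem mul_list_prod_of_mem {ψ : ι → B} (anti : ∀ c d, ψ c * ψ d = -(ψ d * ψ c))
    (sq : ∀ c, ψ c * ψ c = 0) {j : ι} {L : List ι} (hj : j ∈ L) : ψ j * (L.map ψ).prod = 0 := by
  rw [mul_list_prod_of_anticomm (anti j), list_prod_mul_of_mem anti sq hj, mul_zero]

theorem list_prod_perm_of_anticomm {ψ : ι → B} (anti : ∀ c d, ψ c * ψ d = -(ψ d * ψ c))
    {L L' : List ι} (h : L.Perm L') :
    (L.map ψ).prod = (L'.map ψ).prod ∨ (L.map ψ).prod = -(L'.map ψ).prod := by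
  induction h with
  | nil => simp
  | cons c _ ih => rcases ih with h | h <;> simp [h]
  | swap c d L =>
    right
    simp only [List.map_cons, List.prod_cons, ← mul_assoc]
    rw [anti d c, neg_mul]
  | trans _ _ h₁ h₂ => rcases h₁ with h₁ | h₁ <;> rcases h₂ with h₂ | h₂ <;> simp [h₁, h₂]

variable {J : Submodule B B}

/-- If `F` acts on the anticommuting family by `ψ i ↦ -ψ j`, `ψ c ↦ 0` and kills the vacuum, then
it kills every product containing `ψ j`. -/
theorem mul_list_prod_mem_of_mem [DecidableEq ι] {ψ : ι → B}
    (anti : ∀ c d, ψ c * ψ d = -(ψ d * ψ c)) (sq : ∀ c, ψ c * ψ c = 0) {F : B} {i j : ι}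
    (hij : i ≠ j) (hF : ∀ c, F * ψ c = ψ c * F - if c = i then ψ j else 0) (hFJ : F ∈ J)
    {L : List ι} (hj : j ∈ L) : F * (L.map ψ).prod ∈ J := by
  have aux : ∀ L : List ι, ψ j * (F * (L.map ψ).prod) ∈ J := by
    intro L
    induction L with
    | nil => simpa using J.smul_mem (ψ j) hFJ
    | cons c L ih =>
      have h0 : ψ j * (if c = i then ψ j else 0) = 0 := by split_ifs <;> simp [sq]
      have e : ψ j * (F * ((c :: L).map ψ).prod) = -(ψ c * (ψ j * (F * (L.map ψ).prod))) := by
        rw [List.map_cons, List.prod_cons, ← mul_assoc F, hF, sub_mul, mul_sub,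
          ← mul_assoc (ψ j) (ite _ _ _), h0, zero_mul, sub_zero, ← mul_assoc, ← mul_assoc (ψ j),
          anti j c]
        simp only [neg_mul, mul_assoc]
      rw [e]
      exact neg_mem (J.smul_mem _ ih)
  induction L with
  | nil => simp at hj
  | cons c L ih =>
    rw [List.map_cons, List.prod_cons, ← mul_assoc, hF, sub_mul, mul_assoc]
    rcases List.mem_cons.1 hj with rfl | hj
    · rw [if_neg hij.symm, zero_mul, sub_zero]
      exact aux L
    · refine sub_mem (J.smul_mem _ (ih hj)) ?_
      split_ifs
      · rw [mul_list_prod_of_mem anti sq hj]; exact zero_mem _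
      · rw [zero_mul]; exact zero_mem _

theorem mul_list_prod_concat_add_mem [DecidableEq ι] {ψ : ι → B} {F : B} {i y : ι}
    (hF : ∀ c, F * ψ c = ψ c * F - if c = i then ψ y else 0) (hFJ : F ∈ J)
    {L : List ι} (hi : i ∉ L) : F * ((L.map ψ).prod * ψ i) + (L.map ψ).prod * ψ y ∈ J := by
  induction L with
  | nil =>
    rw [List.map_nil, List.prod_nil, one_mul, one_mul, hF, if_pos rfl, sub_add_cancel]
    exact J.smul_mem _ hFJ
  | cons c L ih =>
    rw [List.mem_cons, not_or] at hi
    have e : F * (((c :: L).map ψ).prod * ψ i) + ((c :: L).map ψ).prod * ψ y =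
        ψ c * (F * ((L.map ψ).prod * ψ i) + (L.map ψ).prod * ψ y) := by
      rw [List.map_cons, List.prod_cons, mul_assoc, mul_assoc, ← mul_assoc F, hF,
        if_neg (Ne.symm hi.1), sub_zero, mul_add, mul_assoc]
    rw [e]
    exact J.smul_mem _ (ih hi.2)

/-- The action of a degree one element on a product ending in `ψ i`. -/
theorem mul_list_prod_concat_sub_mem [DecidableEq ι] {ψ ξ F : ι → B}
    (anti : ∀ c d, ψ c * ψ d = -(ψ d * ψ c)) (sq : ∀ c, ψ c * ψ c = 0)
    (anti' : ∀ c d, ξ c * ψ d = -(ψ d * ξ c))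
    {a K : B} {i j : ι} (hF : ∀ y c, F y * ψ c = ψ c * F y - if c = i then ψ y else 0)
    (hFJ : ∀ y, F y ∈ J) (ha : ∀ c, c ≠ i → a * ψ c = ψ c * a + ξ c * F j + ξ j * F c)
    (hai : a * ψ i - ξ j * K ∈ J) {L : List ι} (hi : i ∉ L) (hj : j ∈ L) :
    a * ((L.map ψ).prod * ψ i) - (L.map ψ).prod * ξ j * (K + (L.length + 1 : ℕ)) ∈ J := by
  have swap : ∀ (L : List ι) (c : ι), ξ j * (L.map ψ).prod * ψ c = -(ψ c * (L.map ψ).prod * ξ j) :=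
    fun L c => mul_list_prod_mul_swap (anti' j) (anti c) (anti' j c) L
  have step : ∀ (c : ι) (L : List ι), c ≠ i → i ∉ L → ∀ y,
      a * ((L.map ψ).prod * ψ i) - y ∈ J →
      a * (((c :: L).map ψ).prod * ψ i) -
        (ψ c * y + ψ c * (L.map ψ).prod * ξ j - ξ c * (L.map ψ).prod * ψ j) ∈ J := by
    intro c L hc hL y hy
    have e : a * (((c :: L).map ψ).prod * ψ i) -
        (ψ c * y + ψ c * (L.map ψ).prod * ξ j - ξ c * (L.map ψ).prod * ψ j) =
        ψ c * (a * ((L.map ψ).prod * ψ i) - y) +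
        ξ c * (F j * ((L.map ψ).prod * ψ i) + (L.map ψ).prod * ψ j) +
        ξ j * (F c * ((L.map ψ).prod * ψ i) + (L.map ψ).prod * ψ c) := by
      have h := swap L c
      rw [List.map_cons, List.prod_cons, mul_assoc, ← mul_assoc a, ha c hc]
      linear_combination (norm := noncomm_ring) -h
    rw [e]
    exact add_mem (add_mem (J.smul_mem _ hy)
      (J.smul_mem _ (mul_list_prod_concat_add_mem (hF j) (hFJ j) hL)))
      (J.smul_mem _ (mul_list_prod_concat_add_mem (hF c) (hFJ c) hL))
  have step₀ : ∀ L : List ι, i ∉ L → ∃ y, ψ j * y = 0 ∧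
      a * ((L.map ψ).prod * ψ i) - ((L.map ψ).prod * ξ j * (K + L.length) + y) ∈ J := by
    intro L hL
    induction L with
    | nil => exact ⟨0, mul_zero _, by simpa using hai⟩
    | cons c L ih =>
      rw [List.mem_cons, not_or] at hL
      obtain ⟨y, hy, hyJ⟩ := ih hL.2
      refine ⟨ψ c * y - ξ c * (L.map ψ).prod * ψ j, ?_, ?_⟩
      · have h := mul_list_prod_mul_self (anti j) (sq j) L
        have e : ψ j * (ξ c * (L.map ψ).prod * ψ j) =
            ψ j * ξ c * ((L.map ψ).prod * ψ j) := by simp only [mul_assoc]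
        rw [mul_sub, ← mul_assoc, anti, neg_mul, mul_assoc, hy, e,
          ← neg_eq_iff_eq_neg.2 (anti' c j), neg_mul, mul_assoc, ← mul_assoc (ψ j), h, mul_zero, mul_zero, neg_zero, sub_zero]
      · convert step c L (Ne.symm hL.1) hL.2 _ hyJ using 1
        rw [List.map_cons, List.prod_cons, List.length_cons]
        push_cast
        noncomm_ring
  induction L with
  | nil => simp at hj
  | cons c L ih =>
    rw [List.mem_cons, not_or] at hi
    by_cases hjL : j ∈ L
    · convert step c L (Ne.symm hi.1) hi.2 _ (ih hi.2 hjL) using 1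
      rw [mul_assoc (ξ c), list_prod_mul_of_mem anti sq hjL, List.map_cons, List.prod_cons,
        List.length_cons]
      push_cast
      noncomm_ring
    · obtain rfl : j = c := (List.mem_cons.1 hj).resolve_right hjL
      obtain ⟨y, hy, hyJ⟩ := step₀ L hi.2
      convert step j L (Ne.symm hi.1) hi.2 _ hyJ using 1
      rw [swap, mul_add (ψ j), hy, List.map_cons, List.prod_cons, List.length_cons]
      push_cast
      noncomm_ring

end Anticommuting

section TauE

variable {n : ℕ}

theorem tauE_apply (i j : Fin n) :
    tauE n i j = (if i = j then tauGen n else 0) + eGen n i j (-1) := rfl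

theorem eGen_mul_ite_tauGen (i j k l : Fin n) (r : ℤ) :
    eGen n i j r * (if k = l then tauGen n else 0) - (if k = l then tauGen n else 0) * eGen n i j r
      = if k = l then (r : ℂ) • eGen n i j (r - 1) else 0 := by
  split_ifs
  · rw [eGen_mul_tauGen, add_sub_cancel_left]
  · simp

theorem eGen_mul_tauE (i j k l : Fin n) (r : ℤ) :
    eGen n i j r * tauE n k l - tauE n k l * eGen n i j r =
      (if k = l then (r : ℂ) • eGen n i j (r - 1) else 0)
        + (eGen n i j r * eGen n k l (-1) - eGen n k l (-1) * eGen n i j r) := by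
  rw [← eGen_mul_ite_tauGen, tauE_apply, mul_add, add_mul]
  abel

/-- `τ + E[-1]` is a Manin matrix. -/
theorem tauE_manin (i j k l : Fin n) :
    tauE n i j * tauE n k l - tauE n k l * tauE n i j =
      tauE n k j * tauE n i l - tauE n i l * tauE n k j := by
  have key : ∀ i j k l : Fin n, tauE n i j * tauE n k l - tauE n k l * tauE n i j =
      (if k = j then eGen n i l (-1 + -1) else 0) - (if i = l then eGen n k j (-1 + -1) else 0)
      - (if k = l then eGen n i j (-1 + -1) else 0)
      + (if i = j then eGen n k l (-1 + -1) else 0) := by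
    intro i j k l
    have e : tauE n i j * tauE n k l - tauE n k l * tauE n i j =
        (eGen n i j (-1) * tauE n k l - tauE n k l * eGen n i j (-1))
        - (eGen n k l (-1) * (if i = j then tauGen n else 0)
          - (if i = j then tauGen n else 0) * eGen n k l (-1)) := by
      rw [tauE_apply i j, tauE_apply k l]
      split_ifs <;> noncomm_ring
    rw [e, eGen_mul_ite_tauGen, eGen_mul_tauE, eGen_mul_eGen]
    rw [if_neg (by norm_num : ¬ ((-1 : ℤ) = - -1))]
    have h1 : ∀ i j : Fin n, ((-1 : ℤ) : ℂ) • eGen n i j (-1 - 1) = - eGen n i j (-1 + -1) := by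
      intro i j
      rw [show (-1 - 1 : ℤ) = -1 + -1 by norm_num]
      push_cast
      exact neg_one_smul ℂ (eGen n i j (-1 + -1))
    rw [h1, h1, mul_zero, zero_mul, zero_smul]
    split_ifs <;> abel
  rw [key, key]
  abel

theorem eGen_zero_mul_tauE (i j k l : Fin n) :
    eGen n i j 0 * tauE n k l = tauE n k l * eGen n i j 0
      + (if k = j then tauE n i l else 0) - (if i = l then tauE n k j else 0) := by
  have h := eGen_mul_tauE i j k l 0
  rw [eGen_mul_eGen, Int.cast_zero, zero_mul, zero_mul, zero_add, sub_eq_iff_eq_add] at h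
  have e : (if k = l then (0 : ℂ) • eGen n i j (0 - 1) else 0) = 0 := by simp
  have e' : (0 : ℂ) • KGen n = 0 := zero_smul ℂ (KGen n)
  rw [e, e', add_zero, zero_add] at h
  rw [h, tauE_apply i l, tauE_apply k j]
  by_cases hkj : k = j <;> by_cases hil : i = l <;> simp [hkj, hil] <;> abel

theorem eGen_one_mul_tauE {i j : Fin n} (hij : i ≠ j) (k l : Fin n) :
    eGen n i j 1 * tauE n k l = tauE n k l * eGen n i j 1
      + (if k = l then eGen n i j 0 else 0) + (if k = j then eGen n i l 0 else 0)
      - (if i = l then eGen n k j 0 else 0)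
      + (if k = j then if i = l then KGen n else 0 else 0) := by
  have h := eGen_mul_tauE i j k l 1
  rw [eGen_mul_eGen, sub_eq_iff_eq_add] at h
  have e : (if k = l then ((1 : ℤ) : ℂ) • eGen n i j (1 - 1) else 0)
      = if k = l then eGen n i j 0 else 0 := by
    simp
  have e' : ∀ x : ℂ, ((1 : ℤ) : ℂ) * (if (1 : ℤ) = - -1 then 1 else 0) *
      (x - (if i = j then 1 else 0) * (if k = l then 1 else 0) / (n : ℂ)) = x := by
    intro x
    simp [hij]
  rw [h, e, e']
  by_cases hkj : k = j <;> by_cases hil : i = l <;> simp [hkj, hil] <;> abel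

end TauE

section Fermions

variable {n : ℕ} {B : Type*} [Ring B] [Algebra ℂ B]

/-- The exterior generators `ξ_k`. -/
noncomputable def xi (g : ExteriorAlgebra ℂ (Fin n → ℂ) →ₐ[ℂ] B) (k : Fin n) : B :=
  g (ExteriorAlgebra.ι ℂ (Pi.single k 1))

/-- Commuting copies of `U` (through `ρ`) and of the fermionic creation (through `g`) and
annihilation (`d`) operators in an algebra `B`. -/
structure IsFermionic (ρ : UEA n →ₐ[ℂ] B) (g : ExteriorAlgebra ℂ (Fin n → ℂ) →ₐ[ℂ] B)
    (d : Fin n → B) : Prop where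
  comm_left (u : UEA n) (x : ExteriorAlgebra ℂ (Fin n → ℂ)) : g x * ρ u = ρ u * g x
  comm_right (u : UEA n) (k : Fin n) : d k * ρ u = ρ u * d k
  d_sq (k : Fin n) : d k * d k = 0
  d_anti (k l : Fin n) : d k * d l = -(d l * d k)
  d_mul_xi (k l : Fin n) : d k * xi g l = (if k = l then 1 else 0) - xi g l * d k

/-- The column vectors `ψ_c = ∑ k, M_{kc} ξ_k` of `M = τ + E[-1]`. -/
noncomputable def psi (ρ : UEA n →ₐ[ℂ] B) (g : ExteriorAlgebra ℂ (Fin n → ℂ) →ₐ[ℂ] B)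
    (c : Fin n) : B :=
  ∑ k, ρ (tauE n k c) * xi g k

/-- The left ideal of `B` annihilating the vacuum. -/
def vacuumIdeal (ρ : UEA n →ₐ[ℂ] B) (d : Fin n → B) : Submodule B B :=
  Submodule.span B (ρ '' KnI n ∪ Set.range d)

variable {ρ : UEA n →ₐ[ℂ] B} {g : ExteriorAlgebra ℂ (Fin n → ℂ) →ₐ[ℂ] B} {d : Fin n → B}

theorem map_mem_vacuumIdeal {u : UEA n} (hu : u ∈ KnI n) : ρ u ∈ vacuumIdeal ρ d :=
  Submodule.subset_span (Or.inl ⟨u, hu, rfl⟩)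

theorem mem_vacuumIdeal (k : Fin n) : d k ∈ vacuumIdeal ρ d :=
  Submodule.subset_span (Or.inr ⟨k, rfl⟩)

theorem xi_anti (k l : Fin n) : xi g k * xi g l = -(xi g l * xi g k) := by
  rw [eq_neg_iff_add_eq_zero, xi, xi, ← map_mul g, ← map_mul g, ← map_add g,
    ExteriorAlgebra.ι_add_mul_swap, map_zero]

theorem bosonic_mem_vacuumIdeal (i j : Fin n) : ρ (eGen n i j 0) - xi g j * d i ∈ vacuumIdeal ρ d :=
  sub_mem (map_mem_vacuumIdeal (eGen_mem_KnI i j le_rfl))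
    (Submodule.smul_mem _ (xi g j) (mem_vacuumIdeal i))

namespace IsFermionic

variable (h : IsFermionic ρ g d)
include h

theorem xi_mul (u : UEA n) (k : Fin n) : xi g k * ρ u = ρ u * xi g k := h.comm_left u _

theorem xi_mul_psi (k c : Fin n) : xi g k * psi ρ g c = -(psi ρ g c * xi g k) := by
  rw [psi, Finset.mul_sum, Finset.sum_mul, ← Finset.sum_neg_distrib]
  refine Finset.sum_congr rfl fun l _ => ?_
  rw [← mul_assoc, h.xi_mul, mul_assoc, mul_assoc, xi_anti, mul_neg]

theorem psi_anti (a c : Fin n) : psi ρ g a * psi ρ g c = -(psi ρ g c * psi ρ g a) := by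
  have expand : ∀ a c, psi ρ g a * psi ρ g c =
      ∑ k, ∑ l, ρ (tauE n k a * tauE n l c) * (xi g k * xi g l) := by
    intro a c
    simp only [psi, Finset.sum_mul, Finset.mul_sum]
    rw [Finset.sum_comm]
    refine Finset.sum_congr rfl fun k _ => Finset.sum_congr rfl fun l _ => ?_
    rw [mul_assoc, ← mul_assoc (xi g k), h.xi_mul, map_mul]
    simp only [mul_assoc]
  have sym : ∀ k l, tauE n k a * tauE n l c + tauE n k c * tauE n l a =
      tauE n l a * tauE n k c + tauE n l c * tauE n k a := by
    intro k l
    have := tauE_manin k a l c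
    rw [sub_eq_iff_eq_add] at this
    rw [this]
    abel
  have e : psi ρ g a * psi ρ g c + psi ρ g c * psi ρ g a =
      -(psi ρ g a * psi ρ g c + psi ρ g c * psi ρ g a) := by
    have e₁ : psi ρ g a * psi ρ g c + psi ρ g c * psi ρ g a =
        ∑ k, ∑ l, ρ (tauE n k a * tauE n l c + tauE n k c * tauE n l a) * (xi g k * xi g l) := by
      rw [expand, expand, ← Finset.sum_add_distrib]
      refine Finset.sum_congr rfl fun k _ => ?_
      rw [← Finset.sum_add_distrib]
      refine Finset.sum_congr rfl fun l _ => ?_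
      rw [map_add, add_mul]
    rw [e₁]
    conv_lhs => rw [Finset.sum_comm]
    rw [← Finset.sum_neg_distrib]
    refine Finset.sum_congr rfl fun k _ => ?_
    rw [← Finset.sum_neg_distrib]
    refine Finset.sum_congr rfl fun l _ => ?_
    rw [sym, xi_anti, mul_neg]
  rw [eq_neg_iff_add_eq_zero]
  have two : (2 : ℂ) • (psi ρ g a * psi ρ g c + psi ρ g c * psi ρ g a) = 0 := by
    rw [two_smul]
    nth_rewrite 1 [e]
    exact neg_add_cancel _
  exact (smul_eq_zero.1 two).resolve_left two_ne_zero

theorem psi_sq (c : Fin n) : psi ρ g c * psi ρ g c = 0 := by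
  have e := h.psi_anti c c
  rw [eq_neg_iff_add_eq_zero, ← two_smul ℂ] at e
  exact (smul_eq_zero.1 e).resolve_left two_ne_zero

/-- `e_{ij}[0] - ξ_j ∂_i` acts on the columns by right multiplication. -/
theorem bosonic_mul_psi (i j c : Fin n) :
    (ρ (eGen n i j 0) - xi g j * d i) * psi ρ g c =
      psi ρ g c * (ρ (eGen n i j 0) - xi g j * d i) - if c = i then psi ρ g j else 0 := by
  have e₁ : ρ (eGen n i j 0) * psi ρ g c = psi ρ g c * ρ (eGen n i j 0)
      + ρ (tauE n i c) * xi g j - if c = i then psi ρ g j else 0 := by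
    have : ∀ k, ρ (eGen n i j 0) * (ρ (tauE n k c) * xi g k) =
        ρ (tauE n k c) * xi g k * ρ (eGen n i j 0)
        + (if k = j then ρ (tauE n i c) * xi g k else 0)
        - if c = i then ρ (tauE n k j) * xi g k else 0 := by
      intro k
      rw [← mul_assoc, ← map_mul, eGen_zero_mul_tauE, map_sub, map_add, map_mul, sub_mul, add_mul,
        mul_assoc _ (xi g k), h.xi_mul, mul_assoc]
      simp only [apply_ite ρ, map_zero, ite_mul, zero_mul, eq_comm]
    simp only [psi, Finset.mul_sum, this, Finset.sum_sub_distrib, Finset.sum_add_distrib,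
      Finset.sum_mul]
    simp
  have e₂ : xi g j * d i * psi ρ g c = ρ (tauE n i c) * xi g j + psi ρ g c * (xi g j * d i) := by
    have : ∀ k, xi g j * d i * (ρ (tauE n k c) * xi g k) =
        (if i = k then ρ (tauE n k c) * xi g j else 0)
          + ρ (tauE n k c) * xi g k * (xi g j * d i) := by
      intro k
      rw [← mul_assoc, mul_assoc (xi g j), h.comm_right, ← mul_assoc, h.xi_mul, mul_assoc,
        h.d_mul_xi, mul_assoc, mul_sub, mul_sub, ← mul_assoc (xi g j), xi_anti j k, mul_ite]
      split_ifs <;> simp [mul_assoc]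
    rw [psi, Finset.mul_sum, Finset.sum_congr rfl fun k _ => this k, Finset.sum_add_distrib,
      Finset.sum_mul]
    simp
  rw [sub_mul, e₁, e₂, mul_sub]
  abel

theorem eGen_one_mul_psi {i j : Fin n} (hij : i ≠ j) (c : Fin n) :
    ρ (eGen n i j 1) * psi ρ g c = psi ρ g c * ρ (eGen n i j 1) + xi g c * ρ (eGen n i j 0)
      + xi g j * ρ (eGen n i c 0)
      - (if i = c then ∑ k, xi g k * ρ (eGen n k j 0) else 0)
      + if i = c then xi g j * ρ (KGen n) else 0 := by
  have : ∀ k, ρ (eGen n i j 1) * (ρ (tauE n k c) * xi g k) =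
      ρ (tauE n k c) * xi g k * ρ (eGen n i j 1)
      + (if k = c then xi g k * ρ (eGen n i j 0) else 0)
      + (if k = j then xi g k * ρ (eGen n i c 0) else 0)
      - (if i = c then xi g k * ρ (eGen n k j 0) else 0)
      + if k = j then if i = c then xi g k * ρ (KGen n) else 0 else 0 := by
    intro k
    rw [← mul_assoc, ← map_mul, eGen_one_mul_tauE hij, mul_assoc _ (xi g k), h.xi_mul, h.xi_mul,
      h.xi_mul, h.xi_mul, h.xi_mul]
    simp only [map_add, map_sub, map_mul, add_mul, sub_mul, apply_ite ρ, map_zero, ite_mul,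
      zero_mul, mul_assoc]
  simp only [psi, Finset.mul_sum, this, Finset.sum_sub_distrib, Finset.sum_add_distrib,
    Finset.sum_mul]
  split_ifs <;> simp

theorem d_mul_xi_prod_mem {c : Fin n} {L : List (Fin n)} (hc : c ∉ L) :
    d c * (L.map (xi g)).prod ∈ vacuumIdeal ρ d := by
  induction L with
  | nil => simpa using mem_vacuumIdeal c
  | cons k L ih =>
    rw [List.mem_cons, not_or] at hc
    rw [List.map_cons, List.prod_cons, ← mul_assoc, h.d_mul_xi, if_neg hc.1, zero_sub, neg_mul,
      mul_assoc]
    exact neg_mem (Submodule.smul_mem _ _ (ih hc.2))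

theorem d_prod_mul_xi_prod_sub_one_mem {L : List (Fin n)} (hL : L.Nodup) :
    (L.reverse.map d).prod * (L.map (xi g)).prod - 1 ∈ vacuumIdeal ρ d := by
  induction L with
  | nil => simp
  | cons c L ih =>
    rw [List.nodup_cons] at hL
    have e : ((c :: L).reverse.map d).prod * ((c :: L).map (xi g)).prod - 1 =
        ((L.reverse.map d).prod * (L.map (xi g)).prod - 1) -
          (L.reverse.map d).prod * xi g c * (d c * (L.map (xi g)).prod) := by
      rw [List.reverse_cons, List.map_append, List.prod_append, List.map_singleton,
        List.prod_singleton, List.map_cons, List.prod_cons, mul_assoc, ← mul_assoc (d c),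
        h.d_mul_xi, if_pos rfl, sub_mul, one_mul, mul_sub]
      simp only [mul_assoc]
      abel
    rw [e]
    exact sub_mem (ih hL.2) (Submodule.smul_mem _ _ (h.d_mul_xi_prod_mem hL.1))

theorem d_prod_mul (u : UEA n) (L : List (Fin n)) :
    (L.map d).prod * ρ u = ρ u * (L.map d).prod := by
  induction L with
  | nil => simp
  | cons c L ih => rw [List.map_cons, List.prod_cons, mul_assoc, ih, ← mul_assoc, h.comm_right,
      mul_assoc]

/-- Taking the top exterior coefficient. -/
theorem map_mem_of_d_prod_mul_mem {u : UEA n}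
    (hu : ((List.finRange n).reverse.map d).prod *
      (ρ u * ((List.finRange n).map (xi g)).prod) ∈ vacuumIdeal ρ d) :
    ρ u ∈ vacuumIdeal ρ d := by
  have h₁ := Submodule.smul_mem _ (ρ u) (h.d_prod_mul_xi_prod_sub_one_mem (List.nodup_finRange n))
  rw [← mul_assoc, h.d_prod_mul, mul_assoc] at hu
  have := sub_mem hu h₁
  rwa [smul_eq_mul, mul_sub, mul_one, sub_sub_cancel] at this

theorem list_ofFn_prod_mul {m : ℕ} (u : Fin m → UEA n) (k : Fin m → Fin n) :
    (List.ofFn fun a => ρ (u a) * xi g (k a)).prod =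
      ρ (List.ofFn u).prod * (List.ofFn fun a => xi g (k a)).prod := by
  induction m with
  | zero => simp
  | succ m ih =>
    simp only [List.ofFn_succ, List.prod_cons, ih (fun a => u a.succ) (fun a => k a.succ), map_mul]
    rw [mul_assoc, ← mul_assoc (xi g _), h.xi_mul]
    simp only [mul_assoc]

theorem psi_prod_eq_cdet :
    ((List.finRange n).map (psi ρ g)).prod =
      ρ (cdet (tauE n)) * ((List.finRange n).map (xi g)).prod := by
  let Ξ : (Fin n → Fin n) → ExteriorAlgebra ℂ (Fin n → ℂ) := fun k =>
    ExteriorAlgebra.ιMulti ℂ n fun a => Pi.single (k a) 1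
  have hΞ : ∀ k : Fin n → Fin n, (List.ofFn fun a => xi g (k a)).prod = g (Ξ k) := by
    intro k
    simp only [Ξ, ExteriorAlgebra.ιMulti_apply, map_list_prod, List.map_ofFn]
    rfl
  have hexp : (List.ofFn (psi ρ g)).prod = ∑ k : Fin n → Fin n,
      (List.ofFn fun a => ρ (tauE n (k a) a) * xi g (k a)).prod := by
    have := (MultilinearMap.mkPiAlgebraFin ℂ n B).map_sum
      (fun a k => ρ (tauE n k a) * xi g k)
    simp only [MultilinearMap.mkPiAlgebraFin_apply] at this
    exact this
  rw [← List.ofFn_eq_map, ← List.ofFn_eq_map, hexp, cdet, map_sum, Finset.sum_mul]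
  symm
  refine Fintype.sum_of_injective (fun σ : Equiv.Perm (Fin n) => (σ : Fin n → Fin n))
    DFunLike.coe_injective _ _ ?_ ?_
  · intro k hk
    have hk' : ¬ Function.Injective k := fun hi =>
      hk ⟨Equiv.ofBijective k (Finite.injective_iff_bijective.1 hi), rfl⟩
    rw [h.list_ofFn_prod_mul (fun a => tauE n (k a) a) k, hΞ]
    have : Ξ k = 0 := by
      refine AlternatingMap.map_eq_zero_of_not_injective _ _ fun hi => hk' fun a b hab => hi ?_
      simp only [hab]
    rw [this, map_zero, mul_zero]
  · intro σ
    rw [h.list_ofFn_prod_mul (fun a => tauE n (σ a) a) σ, hΞ σ, hΞ fun a => a]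
    have : Ξ σ = (Equiv.Perm.sign σ : ℤ) • Ξ fun a => a :=
      (ExteriorAlgebra.ιMulti ℂ n).map_perm (fun a => (Pi.single a 1 : Fin n → ℂ)) σ
    rw [this, map_zsmul, map_zsmul, smul_mul_assoc, mul_smul_comm]

theorem map_eGen_zero_mul_cdet_mem {i j : Fin n} (hij : i ≠ j) :
    ρ (eGen n i j 0 * cdet (tauE n)) ∈ vacuumIdeal ρ d := by
  refine h.map_mem_of_d_prod_mul_mem ?_
  rw [map_mul, mul_assoc, ← h.psi_prod_eq_cdet]
  have hd : ((List.finRange n).reverse.map d).prod * (xi g j * d i) = 0 := by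
    have e : xi g j * d i = -(d i * xi g j) := by rw [h.d_mul_xi, if_neg hij, zero_sub, neg_neg]
    rw [e, mul_neg, ← mul_assoc, list_prod_mul_of_mem h.d_anti h.d_sq (by simp), zero_mul, neg_zero]
  have hF := mul_list_prod_mem_of_mem h.psi_anti h.psi_sq hij (h.bosonic_mul_psi i j)
    (bosonic_mem_vacuumIdeal i j) (List.mem_finRange j)
  have := Submodule.smul_mem _ ((List.finRange n).reverse.map d).prod hF
  rwa [smul_eq_mul, ← mul_assoc, mul_sub, hd, sub_zero, mul_assoc] at this

theorem map_eGen_one_mul_cdet_mem {i j : Fin n} (hij : i ≠ j) :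
    ρ (eGen n i j 1 * cdet (tauE n)) ∈ vacuumIdeal ρ d := by
  refine h.map_mem_of_d_prod_mul_mem (Submodule.smul_mem _ _ ?_)
  rw [map_mul, mul_assoc, ← h.psi_prod_eq_cdet]
  set L := (List.finRange n).erase i with hL
  have hperm : (List.finRange n).Perm (L ++ [i]) :=
    (List.perm_cons_erase (List.mem_finRange i)).trans (List.perm_append_singleton i L).symm
  have hlen : L.length + 1 = n := by
    simpa using hperm.length_eq.symm
  have key := mul_list_prod_concat_sub_mem (J := vacuumIdeal ρ d) (ψ := psi ρ g) (ξ := xi g)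
    (F := fun y => ρ (eGen n i y 0) - xi g y * d i) (a := ρ (eGen n i j 1)) (K := ρ (KGen n))
    (i := i) (j := j) (L := L)
    h.psi_anti h.psi_sq h.xi_mul_psi (fun y c => h.bosonic_mul_psi i y c)
    (fun y => bosonic_mem_vacuumIdeal i y)
    (fun c hc => by
      rw [h.eGen_one_mul_psi hij, if_neg (Ne.symm hc), if_neg (Ne.symm hc), mul_sub, mul_sub,
        ← mul_assoc, ← mul_assoc, xi_anti c j, neg_mul]
      abel)
    (by
      rw [h.eGen_one_mul_psi hij, if_pos rfl, if_pos rfl, add_sub_cancel_right]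
      have hm : ∀ (x : B) (k l : Fin n) {r : ℤ}, 0 ≤ r → x * ρ (eGen n k l r) ∈ vacuumIdeal ρ d :=
        fun x k l r hr => Submodule.smul_mem _ x (map_mem_vacuumIdeal (eGen_mem_KnI k l hr))
      exact sub_mem (add_mem (add_mem (hm _ _ _ zero_le_one) (hm _ _ _ le_rfl)) (hm _ _ _ le_rfl))
        (sum_mem fun k _ => hm _ _ _ le_rfl))
    (List.Nodup.not_mem_erase (List.nodup_finRange n))
    ((List.mem_erase_of_ne hij.symm).2 (List.mem_finRange j))
  have hK : ρ (KGen n) + ((L.length + 1 : ℕ) : B) ∈ vacuumIdeal ρ d := by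
    rw [hlen, ← map_natCast ρ, ← map_add]
    exact map_mem_vacuumIdeal KGen_add_mem_KnI
  have hmem := (Submodule.sub_mem_iff_left _ (Submodule.smul_mem _ _ hK)).1 key
  have e : ((L ++ [i]).map (psi ρ g)).prod = (L.map (psi ρ g)).prod * psi ρ g i := by simp
  rcases list_prod_perm_of_anticomm h.psi_anti hperm with hp | hp
  · rwa [hp, e]
  · rw [hp, e, mul_neg]
    exact neg_mem hmem

end IsFermionic

end Fermions

section Extraction

open TensorProduct

variable {n : ℕ}

/-- Operators on the exterior algebra with coefficients in `U`. -/
abbrev FermionAlgebra (n : ℕ) : Type :=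
  UEA n ⊗[ℂ] Module.End ℂ (ExteriorAlgebra ℂ (Fin n → ℂ))

/-- The derivative `∂_k` of the exterior algebra. -/
noncomputable def contraction (k : Fin n) : Module.End ℂ (ExteriorAlgebra ℂ (Fin n → ℂ)) :=
  CliffordAlgebra.contractLeft (Q := (0 : QuadraticForm ℂ (Fin n → ℂ)))
    (LinearMap.proj k : (Fin n → ℂ) →ₗ[ℂ] ℂ)

theorem contraction_one (k : Fin n) : contraction k 1 = 0 :=
  CliffordAlgebra.contractLeft_one _ _

theorem contraction_mul_self (k : Fin n) : contraction k * contraction k = 0 :=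
  LinearMap.ext fun x => CliffordAlgebra.contractLeft_contractLeft _ x

theorem contraction_anti (k l : Fin n) :
    contraction k * contraction l = -(contraction l * contraction k) :=
  LinearMap.ext fun x => CliffordAlgebra.contractLeft_comm _ _ x

theorem contraction_mul_lmul_ι (k l : Fin n) :
    contraction k * Algebra.lmul ℂ _ (ExteriorAlgebra.ι ℂ (Pi.single l 1)) =
      (if k = l then 1 else 0) -
        Algebra.lmul ℂ _ (ExteriorAlgebra.ι ℂ (Pi.single l 1)) * contraction k := by
  refine LinearMap.ext fun x => ?_
  have h : contraction k (ExteriorAlgebra.ι ℂ (Pi.single l 1) * x) =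
      (Pi.single l 1 : Fin n → ℂ) k • x - ExteriorAlgebra.ι ℂ (Pi.single l 1) * contraction k x :=
    CliffordAlgebra.contractLeft_ι_mul _ _ _
  refine h.trans ?_
  by_cases hkl : k = l
  · subst hkl
    simp
  · simp [hkl]

/-- The copy of `U` in the fermion algebra. -/
noncomputable def scalarHom (n : ℕ) : UEA n →ₐ[ℂ] FermionAlgebra n :=
  Algebra.TensorProduct.includeLeft

/-- The copy of the operators on the exterior algebra in the fermion algebra. -/
noncomputable def operatorHom (n : ℕ) :
    Module.End ℂ (ExteriorAlgebra ℂ (Fin n → ℂ)) →ₐ[ℂ] FermionAlgebra n :=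
  Algebra.TensorProduct.includeRight

theorem scalarHom_apply (u : UEA n) : scalarHom n u = u ⊗ₜ 1 := rfl

theorem operatorHom_apply (f : Module.End ℂ (ExteriorAlgebra ℂ (Fin n → ℂ))) :
    operatorHom n f = 1 ⊗ₜ f := rfl

theorem operatorHom_mul_scalarHom (u : UEA n)
    (f : Module.End ℂ (ExteriorAlgebra ℂ (Fin n → ℂ))) :
    operatorHom n f * scalarHom n u = scalarHom n u * operatorHom n f := by
  simp [scalarHom_apply, operatorHom_apply]

theorem isFermionic_scalarHom (n : ℕ) :
    IsFermionic (scalarHom n)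
      ((operatorHom n).comp (Algebra.lmul ℂ (ExteriorAlgebra ℂ (Fin n → ℂ))))
      (fun k => operatorHom n (contraction k)) where
  comm_left u _ := operatorHom_mul_scalarHom u _
  comm_right u _ := operatorHom_mul_scalarHom u _
  d_sq k := by rw [← map_mul, contraction_mul_self, map_zero]
  d_anti k l := by rw [← map_mul, contraction_anti, map_neg, map_mul]
  d_mul_xi k l := by
    rw [xi, AlgHom.comp_apply, ← map_mul, contraction_mul_lmul_ι, map_sub, map_mul]
    congr 1
    split_ifs
    · exact (operatorHom n).map_one
    · exact (operatorHom n).map_zero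

/-- The vacuum expectation `u ⊗ f ↦ ε(f(1)) u`. -/
noncomputable def vacuumExpectation (n : ℕ) : FermionAlgebra n →ₗ[ℂ] UEA n :=
  TensorProduct.rid ℂ (UEA n) ∘ₗ
    LinearMap.lTensor (UEA n) (ExteriorAlgebra.algebraMapInv.toLinearMap ∘ₗ LinearMap.applyₗ 1)

theorem vacuumExpectation_tmul (u : UEA n) (f : Module.End ℂ (ExteriorAlgebra ℂ (Fin n → ℂ))) :
    vacuumExpectation n (u ⊗ₜ f) = ExteriorAlgebra.algebraMapInv (f 1) • u := by
  simp [vacuumExpectation]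

theorem vacuumExpectation_mul_mem_KnI {b : FermionAlgebra n}
    (hb : b ∈ vacuumIdeal (scalarHom n) fun k => operatorHom n (contraction k))
    (a : FermionAlgebra n) : vacuumExpectation n (a * b) ∈ KnI n := by
  induction hb using Submodule.span_induction generalizing a with
  | mem b hb =>
    induction a using TensorProduct.induction_on with
    | zero => simp
    | add a₁ a₂ h₁ h₂ => rw [add_mul, map_add]; exact add_mem h₁ h₂
    | tmul v f =>
      rcases hb with ⟨u, hu, rfl⟩ | ⟨k, rfl⟩
      · rw [scalarHom_apply, Algebra.TensorProduct.tmul_mul_tmul, vacuumExpectation_tmul]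
        exact Submodule.smul_of_tower_mem _ _ (Submodule.smul_mem _ v hu)
      · simp [operatorHom_apply, vacuumExpectation_tmul, contraction_one]
  | zero => simp
  | add x y _ _ hx hy => rw [mul_add, map_add]; exact add_mem (hx a) (hy a)
  | smul c x _ hx => rw [smul_eq_mul, ← mul_assoc]; exact hx _

theorem mem_KnI_of_scalarHom_mem {u : UEA n}
    (hu : scalarHom n u ∈ vacuumIdeal (scalarHom n) fun k => operatorHom n (contraction k)) :
    u ∈ KnI n := by
  have h := vacuumExpectation_mul_mem_KnI hu 1
  rwa [one_mul, scalarHom_apply, vacuumExpectation_tmul, Module.End.one_apply, map_one,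
    one_smul] at h

/-- The column-determinant itself is annihilated by the positive part. -/
theorem eGen_mul_cdet_mem_KnI (i j : Fin n) {r : ℤ} (hr : 0 ≤ r) :
    eGen n i j r * cdet (tauE n) ∈ KnI n :=
  eGen_mul_mem_KnI_of_ne
    (fun _ _ hij => mem_KnI_of_scalarHom_mem
      ((isFermionic_scalarHom n).map_eGen_zero_mul_cdet_mem hij))
    (fun _ _ hij => mem_KnI_of_scalarHom_mem
      ((isFermionic_scalarHom n).map_eGen_one_mul_cdet_mem hij)) i j hr

end Extraction

/-- if `S_1, …, S_n ∈ U(g₋)` are the coefficients in the expansion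
`cdet(τ + E[-1]) = τ^n + S_1 τ^{n-1} + ⋯ + S_n` (powers of `τ` on the right),
then each `S_l` is a Segal–Sugawara vector: `e_{ij}[r] · S_l ∈ (K+n)·U + I`
for all `r ≥ 0`. Here `l : Fin n` corresponds to `S_{l+1}`, which is the
coefficient of `τ^{n-1-l}`. -/
theorem cdet_coeffs_are_segal_sugawara (n : ℕ) (hn : 1 ≤ n)
    (S : Fin n → UEA n) (hS : ∀ l, S l ∈ Uneg n)
    (hdef : cdet (tauE n)
      = tauGen n ^ n + ∑ l : Fin n, S l * tauGen n ^ (n - 1 - (l : ℕ))) :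
    ∀ (l : Fin n) (i j : Fin n) (r : ℤ), 0 ≤ r →
      eGen n i j r * S l ∈ KnI n := by
  intro l i j r hr
  let T : ℕ → UEA n := fun m =>
    Nat.casesOn m 1 fun m => if h : m < n then S ⟨m, h⟩ else 0
  have hT : ∀ m ≤ n, tauShift n (T m) = Polynomial.C (T m) := by
    intro m hm
    cases m with
    | zero => exact (map_one _).trans (map_one _).symm
    | succ m =>
      refine tauShift_of_mem_Uneg ?_
      simp only [T, dif_pos (Nat.lt_of_succ_le hm)]
      exact hS _
  have hsum : cdet (tauE n) = ∑ m ∈ Finset.range (n + 1), T m * tauGen n ^ (n - m) := by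
    rw [hdef, Finset.sum_range_succ', add_comm, ← Fin.sum_univ_eq_sum_range
      (fun m => T (m + 1) * tauGen n ^ (n - (m + 1)))]
    simp [T, Nat.sub_sub, add_comm]
  have h := mul_coeff_mem_KnI (tauShift_eGen i j r) n T hT
    (hsum ▸ eGen_mul_cdet_mem_KnI i j hr) (l + 1) l.2
  simpa [T] using h
end

section
/- For each integer k ≥ 0, write the trace of the k-th power of the matrix τ + E[−1], namely tr(τ + E[−1])^k ∈ U, uniquely in the form T_{k0} τ^k + T_{k1} τ^{k−1} + ⋯ + T_{kk} with powers of τ on the right and coefficients T_{kl} ∈ U(g_-). Then every T_{kl} is a Segal–Sugawara vector: for every basis element e_{ij}[r] with r ≥ 0, the product e_{ij}[r] · T_{kl} lies in (K + n)·U + I, where I is the left ideal of U generated by all e_{ij}[r] with r ≥ 0. -/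
open scoped BigOperators

section ManinIdentity

open Finset

/-- The commutator of two geometric series in noncommuting elements `x` and `y`, compared
coefficientwise. -/
theorem sum_antidiagonal_pow_commutator {A : Type*} [Ring A] (x y : A) (m : ℕ) :
    ∑ a ∈ antidiagonal (m + 2), (x ^ a.1 * y ^ a.2 - y ^ a.2 * x ^ a.1)
      = ∑ p ∈ antidiagonal m, (∑ a ∈ antidiagonal p.1, x ^ a.1 * y ^ a.2) * (x * y - y * x)
          * ∑ a ∈ antidiagonal p.2, y ^ a.2 * x ^ a.1 := by
  set f : PowerSeries A := PowerSeries.mk fun a => x ^ a with hf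
  set g : PowerSeries A := PowerSeries.mk fun a => y ^ a with hg
  have inv (z : A) : (PowerSeries.mk fun a => z ^ a) * (1 - PowerSeries.C z * PowerSeries.X) = 1
      ∧ (1 - PowerSeries.C z * PowerSeries.X) * (PowerSeries.mk fun a => z ^ a) = 1 := by
    constructor
    · ext k
      rcases k with _ | k
      · simp [mul_sub]
      · simp [mul_sub, ← mul_assoc, PowerSeries.coeff_succ_mul_X, PowerSeries.coeff_one, pow_succ]
    · ext k
      rcases k with _ | k
      · simp [sub_mul]
      · rw [(PowerSeries.commute_X (PowerSeries.C z)).eq]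
        simp [sub_mul, mul_assoc, PowerSeries.coeff_succ_X_mul, PowerSeries.coeff_one, pow_succ']
  obtain ⟨hx₁, hx₂⟩ := inv x
  obtain ⟨hy₁, hy₂⟩ := inv y
  rw [← hf] at hx₁ hx₂
  rw [← hg] at hy₁ hy₂
  have key : f * g - g * f
      = PowerSeries.X ^ 2 * (f * g * PowerSeries.C (x * y - y * x) * (g * f)) := by
    have hcomm : (1 - PowerSeries.C x * PowerSeries.X) * (1 - PowerSeries.C y * PowerSeries.X)
        - (1 - PowerSeries.C y * PowerSeries.X) * (1 - PowerSeries.C x * PowerSeries.X)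
        = PowerSeries.X ^ 2 * PowerSeries.C (x * y - y * x) := by
      have h1 := (PowerSeries.commute_X (PowerSeries.C x)).eq
      have h2 := (PowerSeries.commute_X (PowerSeries.C y)).eq
      have e1 : PowerSeries.C x * PowerSeries.X * (PowerSeries.C y * PowerSeries.X)
          = PowerSeries.X ^ 2 * PowerSeries.C (x * y) := by
        rw [h1, h2, map_mul, mul_assoc, ← mul_assoc (PowerSeries.C x), h1]
        simp only [pow_two, mul_assoc]
      have e2 : PowerSeries.C y * PowerSeries.X * (PowerSeries.C x * PowerSeries.X)
          = PowerSeries.X ^ 2 * PowerSeries.C (y * x) := by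
        rw [h1, h2, map_mul, mul_assoc, ← mul_assoc (PowerSeries.C y), h2]
        simp only [pow_two, mul_assoc]
      rw [map_sub, mul_sub (PowerSeries.X ^ 2), ← e1, ← e2]
      noncomm_ring
    calc f * g - g * f
        = f * g * ((1 - PowerSeries.C x * PowerSeries.X) * (1 - PowerSeries.C y * PowerSeries.X)
            - (1 - PowerSeries.C y * PowerSeries.X) * (1 - PowerSeries.C x * PowerSeries.X))
            * (g * f) := by
          have a1 : (1 - PowerSeries.C x * PowerSeries.X)
              * (1 - PowerSeries.C y * PowerSeries.X) * (g * f) = 1 := by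
            rw [mul_assoc, ← mul_assoc _ g f, hy₂, one_mul, hx₂]
          have a2 : f * g * ((1 - PowerSeries.C y * PowerSeries.X)
              * (1 - PowerSeries.C x * PowerSeries.X)) = 1 := by
            rw [mul_assoc, ← mul_assoc g, hy₁, one_mul, hx₁]
          rw [mul_sub, sub_mul, a2, mul_assoc (f * g), a1, mul_one, one_mul]
      _ = _ := by
          rw [hcomm, ← mul_assoc (f * g), ← ((PowerSeries.commute_X (f * g)).pow_right 2).eq.symm]
          simp only [mul_assoc]
  have := congrArg (PowerSeries.coeff (m + 2)) key
  rw [add_comm m 2, PowerSeries.coeff_X_pow_mul', if_pos (by omega), Nat.add_sub_cancel_left]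
    at this
  rw [add_comm m 2]
  have hgf (k : ℕ) : PowerSeries.coeff k (g * f) = ∑ a ∈ antidiagonal k, y ^ a.2 * x ^ a.1 := by
    rw [PowerSeries.coeff_mul, ← Finset.Nat.sum_antidiagonal_swap]
    simp [hf, hg]
  have hfg (k : ℕ) : PowerSeries.coeff k (f * g) = ∑ a ∈ antidiagonal k, x ^ a.1 * y ^ a.2 := by
    rw [PowerSeries.coeff_mul]
    simp [hf, hg]
  rw [map_sub, hfg, hgf, ← Finset.sum_sub_distrib, PowerSeries.coeff_mul] at this
  rw [this]
  refine Finset.sum_congr rfl fun p _ => ?_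
  rw [hgf, PowerSeries.coeff_mul_C, hfg]

/-- If an involution `P` exchanges `x` and `y` and `[x, y] (1 + P) = 0`, then the same relation
holds for the commutator of the geometric series of `x` and `y`. -/
theorem sum_antidiagonal_pow_commutator_mul_one_add {A : Type*} [Ring A] [Module ℚ A]
    (x y P : A) (hP : P * P = 1) (hxP : x * P = P * y) (h : (x * y - y * x) * (1 + P) = 0)
    (m : ℕ) :
    (∑ a ∈ antidiagonal m, (x ^ a.1 * y ^ a.2 - y ^ a.2 * x ^ a.1)) * (1 + P) = 0 := by
  have hyP : y * P = P * x := by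
    rw [← one_mul (y * P), ← hP, mul_assoc P P, ← mul_assoc P y, ← hxP, mul_assoc x, hP, mul_one]
  have hxk (k : ℕ) : x ^ k * P = P * y ^ k := (SemiconjBy.pow_right (a := P) hxP.symm k).eq.symm
  have hyk (k : ℕ) : y ^ k * P = P * x ^ k := (SemiconjBy.pow_right (a := P) hyP.symm k).eq.symm
  have hg (k : ℕ) : (∑ a ∈ antidiagonal k, y ^ a.2 * x ^ a.1) * P
      = P * ∑ a ∈ antidiagonal k, x ^ a.1 * y ^ a.2 := by
    rw [← Finset.Nat.sum_antidiagonal_swap (n := k) (f := fun a => x ^ a.1 * y ^ a.2), sum_mul,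
      mul_sum]
    refine sum_congr rfl fun a _ => ?_
    rw [mul_assoc, hxk, ← mul_assoc, hyk, mul_assoc]
    rfl
  have hh (k : ℕ) : (∑ a ∈ antidiagonal k, x ^ a.1 * y ^ a.2) * P
      = P * ∑ a ∈ antidiagonal k, y ^ a.2 * x ^ a.1 := by
    rw [← one_mul ((∑ a ∈ antidiagonal k, x ^ a.1 * y ^ a.2) * P), ← hP, mul_assoc P P,
      ← mul_assoc P _ P, ← hg, mul_assoc _ P P, hP, mul_one]
  have hDP : (x * y - y * x) * P = -(x * y - y * x) := by
    rw [mul_add, mul_one] at h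
    exact (neg_eq_of_add_eq_zero_right h).symm
  induction m using Nat.strong_induction_on with
  | _ m ih =>
    match m with
    | 0 => simp
    | 1 => simp [Finset.Nat.antidiagonal_succ]
    | m + 2 =>
      rw [sum_antidiagonal_pow_commutator, sum_mul]
      refine sum_eq_zero fun p hp => ?_
      have hlt : p.2 < m + 2 := by
        have := mem_antidiagonal.mp hp
        omega
      have hC := ih p.2 hlt
      rw [sum_sub_distrib] at hC
      have e₁ := hg p.2
      have e₂ := hh p.2
      generalize (∑ a ∈ antidiagonal p.2, x ^ a.1 * y ^ a.2) = u at *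
      generalize (∑ a ∈ antidiagonal p.2, y ^ a.2 * x ^ a.1) = v at *
      generalize x * y - y * x = d at *
      have hzero : d * (u - v) = 0 := by
        have : d * (u - v) + d * (u - v) = 0 := by
          calc d * (u - v) + d * (u - v) = d * (u - v) - d * P * (u - v) := by
                rw [hDP]; noncomm_ring
            _ = d * ((u - v) * (1 + P)) := by
                rw [mul_add, mul_one, sub_mul u v P, e₁, e₂]; noncomm_ring
            _ = 0 := by rw [hC, mul_zero]
        have h2 : (2 : ℚ) • (d * (u - v)) = 0 := by rw [two_smul, this]
        simpa using h2
      have : d * v * (1 + P) = 0 := by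
        calc d * v * (1 + P) = d * v + d * (v * P) := by noncomm_ring
          _ = d * v + d * P * u := by rw [e₁, mul_assoc]
          _ = -(d * (u - v)) := by rw [hDP]; noncomm_ring
          _ = 0 := by rw [hzero, neg_zero]
      rw [mul_assoc, mul_assoc, ← mul_assoc d, this, mul_zero]

/-- For a Manin matrix `M`, the generating series `∑ M ^ a u ^ a` satisfies the Manin relations
as well. -/
theorem manin_sum_pow_commutator {R : Type*} [Ring R] [Module ℚ R] {n : ℕ}
    (M : Matrix (Fin n) (Fin n) R)
    (hM : ∀ i j k l, M i j * M k l - M k l * M i j + (M i l * M k j - M k j * M i l) = 0)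
    (m : ℕ) (i j k l : Fin n) :
    ∑ a ∈ antidiagonal m, (((M ^ a.1) i j * (M ^ a.2) k l - (M ^ a.2) k l * (M ^ a.1) i j)
      + ((M ^ a.1) i l * (M ^ a.2) k j - (M ^ a.2) k j * (M ^ a.1) i l)) = 0 := by
  let ρ : Matrix (Fin n) (Fin n) R →+* Matrix (Fin n) (Fin n) (Matrix (Fin n) (Fin n) R) :=
    (Matrix.scalar (Fin n)).mapMatrix
  let σ : Matrix (Fin n) (Fin n) R →+* Matrix (Fin n) (Fin n) (Matrix (Fin n) (Fin n) R) :=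
    Matrix.scalar (Fin n)
  let P : Matrix (Fin n) (Fin n) (Matrix (Fin n) (Fin n) R) :=
    Matrix.of fun i j => Matrix.single j i 1
  have hρσ (A B : Matrix (Fin n) (Fin n) R) (i j k l) : (ρ A * σ B) i j k l = A i j * B k l := by
    simp [ρ, σ]
  have hσρ (A B : Matrix (Fin n) (Fin n) R) (i j k l) : (σ B * ρ A) i j k l = B k l * A i j := by
    simp [ρ, σ]
  have hZP (Z : Matrix (Fin n) (Fin n) (Matrix (Fin n) (Fin n) R)) (i j k l) :
      (Z * P) i j k l = Z i l k j := by
    simp [P, Matrix.mul_apply, Matrix.sum_apply, Matrix.single_apply, ite_and]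
  have hPZ (Z : Matrix (Fin n) (Fin n) (Matrix (Fin n) (Fin n) R)) (i j k l) :
      (P * Z) i j k l = Z k j i l := by
    simp [P, Matrix.mul_apply, Matrix.sum_apply, Matrix.single_apply, ite_and]
  have key := sum_antidiagonal_pow_commutator_mul_one_add (ρ M) (σ M) P
    (by
      ext i j k l
      rw [hZP]
      simp only [P, Matrix.of_apply, Matrix.one_apply, Matrix.single_apply]
      by_cases h₁ : i = j <;> by_cases h₂ : k = l <;> simp [h₁, h₂, Matrix.one_apply, eq_comm])
    (by
      ext i j k l
      rw [hZP, hPZ]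
      by_cases h : k = j <;> simp [ρ, σ, h])
    (by
      ext i j k l
      rw [mul_add, mul_one, Matrix.add_apply, Matrix.add_apply, hZP]
      simp only [Matrix.sub_apply, hρσ, hσρ]
      exact hM i j k l) m
  have := congrFun (congrFun (congrFun (congrFun key i) j) k) l
  rw [mul_add, mul_one, Matrix.add_apply, Matrix.add_apply, hZP] at this
  simpa only [← map_pow, Matrix.sum_apply, Matrix.sub_apply, hρσ, hσρ, Matrix.zero_apply,
    ← sum_add_distrib] using this

end ManinIdentity

/-- Elements of a `ℂ`-algebra `A` satisfying the defining relations of `U(L)`. -/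
structure AffineSystem (A : Type*) [Ring A] [Algebra ℂ A] (n : ℕ) where
  /-- The images of the `e_{ij}[r]`. -/
  e : Fin n → Fin n → ℤ → A
  /-- The image of `K`. -/
  K : A
  /-- The image of `τ`. -/
  τ : A
  commute_K_e : ∀ i j r, Commute K (e i j r)
  commute_K_τ : Commute K τ
  τ_mul_e : ∀ i j r, τ * e i j r - e i j r * τ = (-r : ℂ) • e i j (r - 1)
  e_mul_e : ∀ i j k l r s, e i j r * e k l s - e k l s * e i j r
      = ((if k = j then e i l (r + s) else 0) - (if i = l then e k j (r + s) else 0))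
        + ((r : ℂ) * (if r = -s then (1 : ℂ) else 0) *
            ((if k = j then (1 : ℂ) else 0) * (if i = l then (1 : ℂ) else 0)
              - (if i = j then (1 : ℂ) else 0) * (if k = l then (1 : ℂ) else 0) / (n : ℂ))) • K

namespace AffineSystem

variable {A : Type*} [Ring A] [Algebra ℂ A] {n : ℕ} (S : AffineSystem A n)

section Relations

/-- The matrix `τ + E[-1]`. -/
def M : Matrix (Fin n) (Fin n) A :=
  Matrix.of fun i j => (if i = j then S.τ else 0) + S.e i j (-1)

/-- The left ideal generated by `K + n` and the `e_{ij}[r]` with `r ≥ 0`. -/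
def J : Submodule A A :=
  Submodule.span A
    (insert (S.K + (n : A)) {x : A | ∃ i j : Fin n, ∃ r : ℤ, 0 ≤ r ∧ x = S.e i j r})

theorem M_apply (i j : Fin n) :
    S.M i j = (if i = j then S.τ else 0) + S.e i j (-1) := rfl

theorem commute_K_M_pow (b : ℕ) (i j : Fin n) : Commute (S.K) ((S.M ^ b) i j) := by
  induction b generalizing i j with
  | zero => by_cases h : i = j <;> simp [h]
  | succ b ih =>
    rw [pow_succ, Matrix.mul_apply]
    refine Commute.sum_right _ _ _ fun s _ => (ih i s).mul_right ?_
    rw [S.M_apply]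
    refine Commute.add_right ?_ (S.commute_K_e ..)
    split_ifs
    exacts [S.commute_K_τ, Commute.zero_right _]

/-- The commutator of `e_{ij}[r]` with an entry of `τ + E[-1]`. -/
theorem e_mul_M (i j k l : Fin n) (r : ℤ) :
    S.e i j r * S.M k l - S.M k l * S.e i j r
      = (if k = l then (r : ℂ) • S.e i j (r - 1) else 0)
        + ((if k = j then S.e i l (r - 1) else 0) - (if i = l then S.e k j (r - 1) else 0))
        + ((r : ℂ) * (if r = 1 then (1 : ℂ) else 0) *
            ((if k = j then (1 : ℂ) else 0) * (if i = l then (1 : ℂ) else 0)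
              - (if i = j then (1 : ℂ) else 0) * (if k = l then (1 : ℂ) else 0) / (n : ℂ)))
          • S.K := by
  have h := S.e_mul_e i j k l r (-1)
  have ht := S.τ_mul_e i j r
  rw [neg_neg, ← sub_eq_add_neg] at h
  rw [add_assoc, ← h, S.M_apply]
  split_ifs
  · rw [neg_smul, ← neg_eq_iff_eq_neg] at ht
    rw [← ht]
    noncomm_ring
  · noncomm_ring

theorem manin_M (i j k l : Fin n) :
    S.M i j * S.M k l - S.M k l * S.M i j
      + (S.M i l * S.M k j - S.M k j * S.M i l) = 0 := by
  have key (i j k l : Fin n) : S.M i j * S.M k l - S.M k l * S.M i j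
      = (if i = j then S.e k l (-2) else 0) - (if k = l then S.e i j (-2) else 0)
        + ((if k = j then S.e i l (-2) else 0) - (if i = l then S.e k j (-2) else 0)) := by
    have h := S.e_mul_M i j k l (-1)
    have ht : S.τ * S.e k l (-1) - S.e k l (-1) * S.τ = S.e k l (-2) := by
      simpa using S.τ_mul_e k l (-1)
    norm_num at h
    have hc : (if i = j then S.τ else 0) * S.M k l
        - S.M k l * (if i = j then S.τ else 0)
        = if i = j then S.e k l (-2) else 0 := by
      rw [S.M_apply]
      by_cases hij : i = j
      · rw [if_pos hij, if_pos hij, ← ht]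
        split_ifs <;> noncomm_ring
      · simp [hij]
    rw [S.M_apply i j, add_mul, mul_add, add_sub_add_comm, hc, h]
    split_ifs <;> module
  rw [key, key i l k j]
  abel

/-- `E[0]` acts on the entries of the powers of `τ + E[-1]` as on matrix units. -/
theorem e_zero_mul_M_pow (b : ℕ) (i j k l : Fin n) :
    S.e i j 0 * (S.M ^ b) k l - (S.M ^ b) k l * S.e i j 0
      = (if k = j then (S.M ^ b) i l else 0) - (if i = l then (S.M ^ b) k j else 0) := by
  have h1 (k l : Fin n) : S.e i j 0 * S.M k l - S.M k l * S.e i j 0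
      = (if k = j then S.M i l else 0) - (if i = l then S.M k j else 0) := by
    have := S.e_mul_M i j k l 0
    simp only [Int.cast_zero, zero_mul, zero_smul, ite_self, zero_add, add_zero, zero_sub] at this
    rw [this, S.M_apply, S.M_apply]
    by_cases h₁ : k = j <;> by_cases h₂ : i = l <;> simp [h₁, h₂]
  induction b generalizing k l with
  | zero =>
    by_cases h₁ : k = j <;> by_cases h₂ : i = l <;> by_cases h₃ : k = l <;>
      simp_all [eq_comm]
  | succ b ih =>
    have hstep (s : Fin n) : S.e i j 0 * ((S.M ^ b) k s * S.M s l)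
        - (S.M ^ b) k s * S.M s l * S.e i j 0
        = ((if k = j then (S.M ^ b) i s else 0) - (if i = s then (S.M ^ b) k j else 0))
            * S.M s l
          + (S.M ^ b) k s
            * ((if s = j then S.M i l else 0) - (if i = l then S.M s j else 0)) := by
      rw [← ih, ← h1]
      noncomm_ring
    simp only [pow_succ, Matrix.mul_apply]
    rw [Finset.mul_sum, Finset.sum_mul, ← Finset.sum_sub_distrib, Finset.sum_congr rfl
      fun s _ => hstep s]
    simp only [Finset.sum_add_distrib, sub_mul, mul_sub, Finset.sum_sub_distrib, ite_mul, mul_ite,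
      zero_mul, mul_zero, Finset.sum_ite_eq, Finset.sum_ite_eq', Finset.mem_univ, if_true]
    split_ifs <;> (simp; try abel)

end Relations

section Vacuum

theorem e_mem (i j : Fin n) {r : ℤ} (hr : 0 ≤ r) : S.e i j r ∈ S.J :=
  Submodule.subset_span (Set.mem_insert_of_mem _ ⟨i, j, r, hr, rfl⟩)

theorem mul_mem_J (u : A) {x : A} (hx : x ∈ S.J) : u * x ∈ S.J :=
  (S.J).smul_mem u hx

theorem smul_mem_J (c : ℂ) {x : A} (hx : x ∈ S.J) : c • x ∈ S.J := by
  rw [← one_mul x, ← smul_mul_assoc]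
  exact S.mul_mem_J _ hx

theorem mul_τ_mem {x : A} (hx : x ∈ S.J) : x * S.τ ∈ S.J := by
  induction hx using Submodule.span_induction with
  | mem x hx =>
    rcases hx with rfl | ⟨i, j, r, hr, rfl⟩
    · have : (S.K + (n : A)) * S.τ = S.τ * (S.K + (n : A)) :=
        (S.commute_K_τ.add_left (Nat.cast_commute n _)).eq
      rw [this]
      exact S.mul_mem_J _ (Submodule.subset_span (Set.mem_insert _ _))
    · have h := S.τ_mul_e i j r
      rw [sub_eq_iff_eq_add', ← sub_eq_iff_eq_add] at h
      rw [← h]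
      refine sub_mem (S.mul_mem_J _ (S.e_mem i j hr)) ?_
      rcases hr.eq_or_lt with rfl | hr
      · simp
      · exact S.smul_mem_J _ (S.e_mem i j (by omega))
  | zero => simp
  | add x y _ _ hx hy => rw [add_mul]; exact add_mem hx hy
  | smul a x _ hx => rw [smul_mul_assoc]; exact S.mul_mem_J a hx

theorem mul_τ_pow_mem {x : A} (hx : x ∈ S.J) (m : ℕ) :
    x * S.τ ^ m ∈ S.J := by
  induction m with
  | zero => simpa
  | succ m ih => rw [pow_succ, ← mul_assoc]; exact S.mul_τ_mem ih

theorem K_mul_M_pow_add_mem (b : ℕ) (k l : Fin n) :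
    S.K * (S.M ^ b) k l + (n : ℂ) • (S.M ^ b) k l ∈ S.J := by
  have : S.K * (S.M ^ b) k l + (n : ℂ) • (S.M ^ b) k l
      = (S.M ^ b) k l * (S.K + (n : A)) := by
    rw [(S.commute_K_M_pow b k l).eq, mul_add, Nat.cast_smul_eq_nsmul, nsmul_eq_mul,
      (Nat.cast_commute n _).eq]
  rw [this]
  exact S.mul_mem_J _ (Submodule.subset_span (Set.mem_insert _ _))

theorem e_zero_mul_M_pow_sub_mem (b : ℕ) (i j k l : Fin n) :
    S.e i j 0 * (S.M ^ b) k l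
      - ((if k = j then (S.M ^ b) i l else 0) - (if i = l then (S.M ^ b) k j else 0))
      ∈ S.J := by
  rw [← S.e_zero_mul_M_pow, sub_sub_cancel]
  exact S.mul_mem_J _ (S.e_mem i j le_rfl)

theorem e_zero_mul_trace_mem (k : ℕ) (i j : Fin n) :
    S.e i j 0 * Matrix.trace (S.M ^ k) ∈ S.J := by
  have h : S.e i j 0 * Matrix.trace (S.M ^ k) - Matrix.trace (S.M ^ k) * S.e i j 0
      = 0 := by
    simp only [Matrix.trace, Matrix.diag_apply, Finset.mul_sum, Finset.sum_mul,
      ← Finset.sum_sub_distrib, S.e_zero_mul_M_pow]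
    simp
  rw [sub_eq_zero.mp h]
  exact S.mul_mem_J _ (S.e_mem i j le_rfl)

theorem scalar_commutator_pow {R : Type*} [Ring R] (c : R) (M : R) (k : ℕ) :
    c * M ^ k - M ^ k * c = ∑ a ∈ Finset.range k, M ^ a * (c * M - M * c) * M ^ (k - 1 - a) := by
  induction k with
  | zero => simp
  | succ k ih =>
    rw [Finset.sum_range_succ]
    have : ∀ a ∈ Finset.range k, M ^ a * (c * M - M * c) * M ^ (k + 1 - 1 - a)
        = M ^ a * (c * M - M * c) * M ^ (k - 1 - a) * M := by
      intro a ha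
      have := Finset.mem_range.mp ha
      rw [mul_assoc _ _ M, ← pow_succ]
      congr 2
      omega
    rw [Finset.sum_congr rfl this, ← Finset.sum_mul, ← ih]
    simp only [Nat.add_sub_cancel, Nat.sub_self, pow_zero, mul_one, pow_succ]
    noncomm_ring

/-- Contribution to `e_{ij}[1] tr (τ + E[-1]) ^ k`, modulo `S.J`, of commuting `e_{ij}[1]` with
one of the factors. -/
theorem commutator_e_one_mul_sub_mem (hn : 1 ≤ n) (b : ℕ) (i j s t p : Fin n) :
    (S.e i j 1 * S.M s t - S.M s t * S.e i j 1) * (S.M ^ b) t p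
      - ((if s = t then
            ((if t = j then (S.M ^ b) i p else 0) - (if i = p then (S.M ^ b) t j else 0))
          else 0)
        + (if s = j then ((S.M ^ b) i p - (if i = p then (S.M ^ b) t t else 0)) else 0)
        - (if i = t then
            ((if t = j then (S.M ^ b) s p else 0) - (if s = p then (S.M ^ b) t j else 0))
          else 0)
        - (if s = j then (if i = t then (n : A) * (S.M ^ b) t p else 0) else 0)
        + (if i = j then (if s = t then (S.M ^ b) t p else 0) else 0)) ∈ S.J := by
  have h1 := S.e_zero_mul_M_pow_sub_mem b i j t p
  have h2 := S.e_zero_mul_M_pow_sub_mem b i t t p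
  have h3 := S.e_zero_mul_M_pow_sub_mem b s j t p
  have hK := S.K_mul_M_pow_add_mem b t p
  have hn' : (n : ℂ) ≠ 0 := by exact_mod_cast (by omega : n ≠ 0)
  rw [if_pos rfl] at h2
  have hite (q : Prop) [Decidable q] {x : A} (hx : x ∈ S.J) :
      (if q then x else 0) ∈ S.J := by
    split_ifs
    exacts [hx, zero_mem _]
  have := add_mem (sub_mem (add_mem (hite (s = t) h1) (hite (s = j) h2)) (hite (i = t) h3))
    (S.smul_mem_J ((if s = j then (1 : ℂ) else 0) * (if i = t then (1 : ℂ) else 0)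
              - (if i = j then (1 : ℂ) else 0) * (if s = t then (1 : ℂ) else 0) / (n : ℂ)) hK)
  rw [S.e_mul_M]
  convert this using 1
  simp only [Int.cast_one, one_mul, one_smul, sub_self, if_true, mul_one, smul_add, smul_smul,
    sub_mul, div_mul_cancel₀ _ hn']
  have hcast (x : A) : (n : A) * x = (n : ℂ) • x := by
    rw [Nat.cast_smul_eq_nsmul, nsmul_eq_mul]
  simp only [hcast, add_mul, sub_mul, smul_mul_assoc]
  generalize (if t = j then (S.M ^ b) i p else 0) - (if i = p then (S.M ^ b) t j else 0) = X₁
  generalize (S.M ^ b) i p - (if i = p then (S.M ^ b) t t else 0) = X₂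
  generalize (if t = j then (S.M ^ b) s p else 0) - (if s = p then (S.M ^ b) t j else 0) = X₃
  split_ifs <;> (try simp only [zero_mul]) <;> module

theorem sum_e_one_contribution {R : Type*} [Ring R] (A B : Matrix (Fin n) (Fin n) R)
    (i j : Fin n) :
    ∑ p, ∑ s, ∑ t, A p s * ((if s = t then ((if t = j then B i p else 0)
          - (if i = p then B t j else 0)) else 0)
        + (if s = j then (B i p - (if i = p then B t t else 0)) else 0)
        - (if i = t then ((if t = j then B s p else 0) - (if s = p then B t j else 0)) else 0)
        - (if s = j then (if i = t then (n : R) * B t p else 0) else 0)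
        + (if i = j then (if s = t then B t p else 0) else 0))
      = ∑ p, A p j * B i p - (A * B) i j - A i j * Matrix.trace B + Matrix.trace A * B i j := by
  simp only [mul_add, mul_sub, mul_ite, mul_zero, Finset.sum_add_distrib, Finset.sum_sub_distrib,
    Finset.sum_ite_eq, Finset.sum_ite_eq', Finset.mem_univ, if_true, Finset.sum_ite_irrel,
    Finset.sum_const_zero, Finset.sum_const, Finset.card_univ, Fintype.card_fin, nsmul_eq_mul,
    Nat.cast_comm]
  simp only [← mul_assoc, Matrix.mul_apply, Matrix.trace, Matrix.diag_apply, Finset.mul_sum,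
    Finset.sum_mul]
  abel

theorem sum_antidiagonal_contribution_eq_zero (m : ℕ) (i j : Fin n) :
    ∑ a ∈ Finset.HasAntidiagonal.antidiagonal m, (∑ p, (S.M ^ a.1) p j * (S.M ^ a.2) i p
        - (S.M ^ a.1 * S.M ^ a.2) i j - (S.M ^ a.1) i j * Matrix.trace (S.M ^ a.2)
        + Matrix.trace (S.M ^ a.1) * (S.M ^ a.2) i j) = 0 := by
  let : Module ℚ A := Module.compHom A (algebraMap ℚ ℂ)
  have h := Finset.sum_eq_zero fun p (_ : p ∈ Finset.univ) =>
    manin_sum_pow_commutator S.M S.manin_M m p p i j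
  rw [Finset.sum_comm] at h
  have hswap : ∑ a ∈ Finset.HasAntidiagonal.antidiagonal m,
        (S.M ^ a.1) i j * Matrix.trace (S.M ^ a.2)
      = ∑ a ∈ Finset.HasAntidiagonal.antidiagonal m, (S.M ^ a.2) i j * Matrix.trace (S.M ^ a.1) :=
    Finset.Nat.sum_antidiagonal_swap (n := m)
      (f := fun a => (S.M ^ a.2) i j * Matrix.trace (S.M ^ a.1))
  rw [Finset.sum_add_distrib, Finset.sum_sub_distrib, hswap, ← Finset.sum_sub_distrib,
    ← Finset.sum_add_distrib, ← h]
  refine Finset.sum_congr rfl fun a _ => ?_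
  rw [← pow_add, add_comm a.1, pow_add, Matrix.mul_apply]
  simp only [Matrix.trace, Matrix.diag_apply, Finset.mul_sum, Finset.sum_mul,
    Finset.sum_add_distrib, Finset.sum_sub_distrib]
  abel

theorem e_one_mul_trace_mem (hn : 1 ≤ n) (k : ℕ) (i j : Fin n) :
    S.e i j 1 * Matrix.trace (S.M ^ k) ∈ S.J := by
  have htr : S.e i j 1 * Matrix.trace (S.M ^ k)
      = Matrix.trace (S.M ^ k) * S.e i j 1 + Matrix.trace
        (Matrix.scalar (Fin n) (S.e i j 1) * S.M ^ k
          - S.M ^ k * Matrix.scalar (Fin n) (S.e i j 1)) := by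
    simp [Matrix.trace, Finset.mul_sum, Finset.sum_mul]
  rw [htr]
  refine add_mem (S.mul_mem_J _ (S.e_mem i j zero_le_one)) ?_
  rcases k with _ | m
  · simp
  have hterm (a b : ℕ) : Matrix.trace (S.M ^ a * (Matrix.scalar (Fin n) (S.e i j 1) * S.M
        - S.M * Matrix.scalar (Fin n) (S.e i j 1)) * S.M ^ b)
      - (∑ p, (S.M ^ a) p j * (S.M ^ b) i p - (S.M ^ a * S.M ^ b) i j
        - (S.M ^ a) i j * Matrix.trace (S.M ^ b) + Matrix.trace (S.M ^ a) * (S.M ^ b) i j)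
      ∈ S.J := by
    have : Matrix.trace (S.M ^ a * (Matrix.scalar (Fin n) (S.e i j 1) * S.M
          - S.M * Matrix.scalar (Fin n) (S.e i j 1)) * S.M ^ b)
        = ∑ p, ∑ s, ∑ t, (S.M ^ a) p s *
          ((S.e i j 1 * S.M s t - S.M s t * S.e i j 1) * (S.M ^ b) t p) := by
      have hD (s t : Fin n) : (Matrix.scalar (Fin n) (S.e i j 1) * S.M
          - S.M * Matrix.scalar (Fin n) (S.e i j 1)) s t
          = S.e i j 1 * S.M s t - S.M s t * S.e i j 1 := by simp
      simp only [← hD]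
      generalize Matrix.scalar (Fin n) (S.e i j 1) * S.M
        - S.M * Matrix.scalar (Fin n) (S.e i j 1) = D
      simp only [Matrix.mul_assoc, Matrix.trace, Matrix.diag_apply, Matrix.mul_apply (M := S.M ^ a),
        Matrix.mul_apply (M := D), Finset.mul_sum]
    rw [this, ← sum_e_one_contribution]
    simp only [← Finset.sum_sub_distrib, ← mul_sub]
    exact sum_mem fun p _ => sum_mem fun s _ => sum_mem fun t _ => S.mul_mem_J _
      (S.commutator_e_one_mul_sub_mem hn b i j s t p)
  rw [scalar_commutator_pow, Matrix.trace_sum, Nat.add_sub_cancel,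
    ← Finset.Nat.sum_antidiagonal_eq_sum_range_succ (fun a b => Matrix.trace (S.M ^ a
      * (Matrix.scalar (Fin n) (S.e i j 1) * S.M - S.M * Matrix.scalar (Fin n) (S.e i j 1))
      * S.M ^ b)), ← sub_zero (Finset.sum _ _), ← S.sum_antidiagonal_contribution_eq_zero m i j,
    ← Finset.sum_sub_distrib]
  exact sum_mem fun a _ => hterm a.1 a.2

theorem sum_e_mul_M (hn : 1 ≤ n) (r : ℤ) (k l : Fin n) :
    (∑ i, S.e i i r) * S.M k l
      = S.M k l * (∑ i, S.e i i r) + if k = l then (r : ℂ) • ∑ i, S.e i i (r - 1) else 0 := by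
  have hn' : (n : ℂ) ≠ 0 := by exact_mod_cast (by omega : n ≠ 0)
  rw [← sub_eq_iff_eq_add', Finset.sum_mul, Finset.mul_sum, ← Finset.sum_sub_distrib,
    Finset.sum_congr rfl fun i _ => S.e_mul_M i i k l r]
  simp only [if_true, one_mul, Finset.sum_add_distrib, Finset.sum_sub_distrib, Finset.sum_ite_eq,
    Finset.sum_ite_eq', Finset.mem_univ, sub_self, add_zero, ← Finset.sum_smul, ← Finset.mul_sum,
    ite_mul, zero_mul, Finset.sum_const, Finset.card_univ, Fintype.card_fin, Finset.sum_ite_irrel,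
    Finset.smul_sum]
  by_cases h : k = l <;> simp [h, hn']

theorem sum_e_mul_M_pow_mem (hn : 1 ≤ n) (k : ℕ) (r : ℤ) (hr : 0 ≤ r) (p q : Fin n) :
    (∑ i, S.e i i r) * (S.M ^ k) p q ∈ S.J := by
  induction k generalizing r p with
  | zero =>
    by_cases h : p = q
    · simpa [h] using sum_mem fun i _ => S.e_mem i i hr
    · simp [h]
  | succ k ih =>
    rw [pow_succ', Matrix.mul_apply, Finset.mul_sum]
    refine sum_mem fun s _ => ?_
    rw [← mul_assoc, S.sum_e_mul_M hn, add_mul, mul_assoc]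
    refine add_mem (S.mul_mem_J _ (ih r hr s)) ?_
    split_ifs
    · rw [smul_mul_assoc]
      rcases hr.eq_or_lt with rfl | hr
      · simp
      · exact S.smul_mem_J _ (ih (r - 1) (by omega) s)
    · simp

/-- The traces of the powers of `τ + E[-1]` are annihilated by all `e_{ij}[r]` with `r ≥ 0`,
modulo the left ideal `J`. -/
theorem e_mul_trace_mem (hn : 1 ≤ n) (k : ℕ) (i j : Fin n) {r : ℤ} (hr : 0 ≤ r) :
    S.e i j r * Matrix.trace (S.M ^ k) ∈ S.J := by
  have hn' : (n : ℂ) ≠ 0 := by exact_mod_cast (by omega : n ≠ 0)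
  obtain ⟨r, rfl⟩ := Int.eq_ofNat_of_zero_le hr
  clear hr
  induction r using Nat.twoStepInduction generalizing i j with
  | zero => exact S.e_zero_mul_trace_mem k i j
  | one => exact S.e_one_mul_trace_mem hn k i j
  | more r _ ih =>
    have hcomm : (n : ℂ) • S.e i j ((r + 2 : ℕ) : ℤ)
        = ∑ l, (S.e i l 1 * S.e l j ((r + 1 : ℕ) : ℤ) - S.e l j ((r + 1 : ℕ) : ℤ) * S.e i l 1)
          + if i = j then ∑ l, S.e l l ((r + 2 : ℕ) : ℤ) else 0 := by
      have hne : ¬ (1 : ℤ) = -((r + 1 : ℕ) : ℤ) := by omega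
      have hadd : (1 : ℤ) + ((r + 1 : ℕ) : ℤ) = ((r + 2 : ℕ) : ℤ) := by push_cast; ring
      simp only [S.e_mul_e, hne, hadd, if_true, if_false, mul_zero, zero_mul, zero_smul, add_zero,
        smul_zero, Finset.sum_sub_distrib, Finset.sum_const, Finset.card_univ, Fintype.card_fin,
        Finset.sum_ite_irrel, Nat.cast_smul_eq_nsmul, sub_add_cancel]
    have hsum : (∑ l, S.e l l ((r + 2 : ℕ) : ℤ)) * Matrix.trace (S.M ^ k) ∈ S.J := by
      rw [Matrix.trace, Finset.mul_sum]
      exact sum_mem fun p _ => S.sum_e_mul_M_pow_mem hn k _ (by positivity) p p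
    have : (n : ℂ) • (S.e i j ((r + 2 : ℕ) : ℤ) * Matrix.trace (S.M ^ k)) ∈ S.J := by
      rw [← smul_mul_assoc, hcomm, add_mul, Finset.sum_mul]
      refine add_mem (sum_mem fun l _ => ?_) ?_
      · rw [sub_mul, mul_assoc, mul_assoc]
        exact sub_mem (S.mul_mem_J _ (ih l j))
          (S.mul_mem_J _ (S.e_one_mul_trace_mem hn k i l))
      · split_ifs
        · exact hsum
        · simp
    simpa [smul_smul, hn'] using S.smul_mem_J (n : ℂ)⁻¹ this

end Vacuum

section Derivation

/-- If `δ` is the derivation `∂/∂τ` and `x` maps all traces `tr (τ + E[-1]) ^ k` to `J`, then it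
maps all their `τ`-coefficients to `J`. -/
theorem mul_coeff_mem (δ : A →ₗ[ℂ] A) (hδ : ∀ x y, δ (x * y) = δ x * y + x * δ y)
    (hδe : ∀ i j r, δ (S.e i j r) = 0) (hδτ : δ S.τ = 1) (x : A)
    (hx : ∀ k, x * Matrix.trace (S.M ^ k) ∈ S.J) (k : ℕ) (T : ℕ → A) (hT : ∀ l, δ (T l) = 0)
    (h : Matrix.trace (S.M ^ k) = ∑ l ∈ Finset.range (k + 1), T l * S.τ ^ (k - l)) (l : ℕ)
    (hl : l ≤ k) : x * T l ∈ S.J := by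
  have hδ1 : δ 1 = 0 := by simpa using hδ 1 1
  have hδτpow (m : ℕ) : δ (S.τ ^ (m + 1)) = ((m : ℂ) + 1) • S.τ ^ m := by
    induction m with
    | zero => simp [hδτ]
    | succ m ih =>
      rw [pow_succ, hδ, ih, hδτ, smul_mul_assoc, ← pow_succ, mul_one]
      push_cast
      module
  have hδM (i j : Fin n) : δ (S.M i j) = (1 : Matrix (Fin n) (Fin n) A) i j := by
    rw [S.M_apply, map_add, hδe, add_zero]
    by_cases h : i = j <;> simp [Matrix.one_apply, h, hδτ]
  have hδMpow (m : ℕ) (i j : Fin n) :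
      δ ((S.M ^ (m + 1)) i j) = ((m : ℂ) + 1) • (S.M ^ m) i j := by
    induction m generalizing i j with
    | zero => simp [hδM]
    | succ m ih =>
      have : δ ((S.M ^ (m + 1) * S.M) i j)
          = ((((m : ℂ) + 1) • S.M ^ m) * S.M + S.M ^ (m + 1) * 1 :
              Matrix (Fin n) (Fin n) A) i j := by
        rw [Matrix.mul_apply, map_sum, Matrix.add_apply, Matrix.mul_apply, Matrix.mul_apply,
          ← Finset.sum_add_distrib]
        exact Finset.sum_congr rfl fun s _ => by rw [hδ, ih, hδM]; rfl
      rw [pow_succ, this, smul_mul_assoc, ← pow_succ, mul_one, Matrix.add_apply, Matrix.smul_apply]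
      push_cast
      module
  induction k generalizing T l with
  | zero =>
    obtain rfl : l = 0 := by omega
    have : T 0 = Matrix.trace (S.M ^ 0) := by rw [h]; simp
    rw [this]
    exact hx 0
  | succ k ih =>
    have hk : (k : ℂ) + 1 ≠ 0 := by exact_mod_cast k.succ_ne_zero
    have hlow (l : ℕ) (hl : l ≤ k) : x * T l ∈ S.J := by
      have hc : ((k : ℂ) + 1 - l) / (k + 1) ≠ 0 := by
        refine div_ne_zero ?_ hk
        rw [sub_ne_zero]
        exact_mod_cast (by omega : k + 1 ≠ l)
      have hmem := ih (fun l => (((k : ℂ) + 1 - l) / (k + 1)) • T l) (fun l => by simp [hT])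
        (by
          have hd := congrArg δ h
          rw [Finset.sum_range_succ, map_add, Nat.sub_self, pow_zero, mul_one, hT, add_zero,
            map_sum, Matrix.trace, map_sum] at hd
          simp only [Matrix.diag_apply, hδMpow, ← Finset.smul_sum] at hd
          rw [← inv_smul_smul₀ hk (Matrix.trace (S.M ^ k))]
          refine (congrArg (((k : ℂ) + 1)⁻¹ • ·) hd).trans ?_
          simp only [Finset.smul_sum]
          refine Finset.sum_congr rfl fun l hl => ?_
          obtain ⟨m, rfl⟩ := Nat.exists_eq_add_of_le (Nat.lt_succ_iff.mp (Finset.mem_range.mp hl))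
          rw [hδ, hT, zero_mul, zero_add, add_assoc, Nat.add_sub_cancel_left, hδτpow,
            Nat.add_sub_cancel_left, mul_smul_comm, smul_smul, smul_mul_assoc]
          congr 1
          push_cast
          ring) l hl
      rw [mul_smul_comm] at hmem
      simpa only [inv_smul_smul₀ hc] using
        S.smul_mem_J (((k : ℂ) + 1 - l) / (k + 1))⁻¹ hmem
    rcases hl.eq_or_lt with rfl | hl
    · have hlast : T (k + 1) = Matrix.trace (S.M ^ (k + 1))
          - ∑ l ∈ Finset.range (k + 1), T l * S.τ ^ (k + 1 - l) := by
        rw [h, Finset.sum_range_succ]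
        simp
      rw [hlast, mul_sub, Finset.mul_sum]
      refine sub_mem (hx _) (sum_mem fun l hl => ?_)
      rw [← mul_assoc]
      exact S.mul_τ_pow_mem (hlow l (Nat.lt_succ_iff.mp (Finset.mem_range.mp hl))) _
    · exact hlow l (Nat.lt_succ_iff.mp hl)

/-- The deformation `τ ↦ τ + ε` of a system over the dual numbers. -/
def dual : AffineSystem (DualNumber A) n where
  e i j r := TrivSqZeroExt.inl (S.e i j r)
  K := TrivSqZeroExt.inl S.K
  τ := TrivSqZeroExt.inl S.τ + TrivSqZeroExt.inr 1
  commute_K_e i j r := by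
    simpa [Commute, SemiconjBy, ← TrivSqZeroExt.inl_mul] using
      congrArg TrivSqZeroExt.inl (S.commute_K_e i j r).eq
  commute_K_τ := by
    ext
    · simpa using S.commute_K_τ.eq
    · simp
  τ_mul_e i j r := by
    ext
    · simpa using S.τ_mul_e i j r
    · simp
  e_mul_e i j k l r s := by
    ext
    · simpa [apply_ite TrivSqZeroExt.fst] using S.e_mul_e i j k l r s
    · simp [apply_ite TrivSqZeroExt.snd]

end Derivation

/-- The system of generators of `U(L)` itself. -/
noncomputable def ofUEA (n : ℕ) : AffineSystem (UEA n) n where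
  e := eGen n
  K := KGen n
  τ := tauGen n
  commute_K_e i j r := by
    have := RingQuot.mkAlgHom_rel ℂ (AffRel.KE i j r)
    simp only [map_mul] at this
    exact this
  commute_K_τ := by
    have := RingQuot.mkAlgHom_rel ℂ (AffRel.KT (n := n))
    simp only [map_mul] at this
    exact this
  τ_mul_e i j r := by
    have := RingQuot.mkAlgHom_rel ℂ (AffRel.TE i j r)
    simp only [map_sub, map_mul, map_smul] at this
    exact this
  e_mul_e i j k l r s := by
    have := RingQuot.mkAlgHom_rel ℂ (AffRel.EE i j k l r s)
    simp only [map_add, map_sub, map_mul, map_smul] at this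
    rw [apply_ite (RingQuot.mkAlgHom ℂ (AffRel n)), apply_ite (RingQuot.mkAlgHom ℂ (AffRel n)),
      map_zero] at this
    exact this

/-- The values on generators of the homomorphism determined by a system. -/
def genMap : AffGen n → A
  | .E i j r => S.e i j r
  | .K => S.K
  | .T => S.τ

/-- The universal property of `U(L)`. -/
noncomputable def lift : UEA n →ₐ[ℂ] A :=
  RingQuot.liftAlgHom ℂ ⟨FreeAlgebra.lift ℂ S.genMap, by
    intro x y h
    cases h with
    | KE i j r => simpa [genMap] using (S.commute_K_e i j r).eq
    | KT => simpa [genMap] using S.commute_K_τ.eq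
    | TE i j r => simpa [genMap] using S.τ_mul_e i j r
    | EE i j k l r s =>
      simp only [map_add, map_sub, map_mul, map_smul]
      rw [apply_ite (FreeAlgebra.lift ℂ S.genMap), apply_ite (FreeAlgebra.lift ℂ S.genMap),
        map_zero]
      simpa only [FreeAlgebra.lift_ι_apply, genMap] using S.e_mul_e i j k l r s⟩

theorem lift_eGen (i j : Fin n) (r : ℤ) : S.lift (eGen n i j r) = S.e i j r := by
  simp [lift, eGen, genMap]

theorem lift_KGen : S.lift (KGen n) = S.K := by
  simp [lift, KGen, genMap]

theorem lift_tauGen : S.lift (tauGen n) = S.τ := by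
  simp [lift, tauGen, genMap]

/-- The derivation `∂/∂τ` of `U(L)`. -/
theorem exists_derivation (n : ℕ) : ∃ δ : UEA n →ₗ[ℂ] UEA n,
    (∀ x y, δ (x * y) = δ x * y + x * δ y) ∧ (∀ i j r, δ (eGen n i j r) = 0) ∧
      δ (tauGen n) = 1 := by
  let φ := (ofUEA n).dual.lift
  have hfst : (TrivSqZeroExt.fstHom ℂ (UEA n) (UEA n)).comp φ = AlgHom.id ℂ (UEA n) := by
    refine RingQuot.ringQuot_ext' ℂ _ _ (FreeAlgebra.hom_ext (funext fun g => ?_))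
    cases g with
    | E i j r => exact congrArg TrivSqZeroExt.fst ((ofUEA n).dual.lift_eGen i j r)
    | K => exact congrArg TrivSqZeroExt.fst ((ofUEA n).dual.lift_KGen)
    | T =>
      refine (congrArg TrivSqZeroExt.fst ((ofUEA n).dual.lift_tauGen)).trans ?_
      exact add_zero _
  have hfst' (x : UEA n) : (φ x).fst = x := DFunLike.congr_fun hfst x
  refine ⟨(TrivSqZeroExt.sndHom (UEA n) (UEA n)).restrictScalars ℂ ∘ₗ φ.toLinearMap,
    fun x y => ?_, fun i j r => ?_, ?_⟩
  · have : (φ (x * y)).snd = (φ x).fst * (φ y).snd + (φ x).snd * (φ y).fst := by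
      rw [map_mul]
      rfl
    rw [hfst', hfst', add_comm] at this
    exact this
  · exact congrArg TrivSqZeroExt.snd ((ofUEA n).dual.lift_eGen i j r)
  · refine (congrArg TrivSqZeroExt.snd ((ofUEA n).dual.lift_tauGen)).trans ?_
    exact zero_add _

theorem derivation_eq_zero_of_mem_Uneg (δ : UEA n →ₗ[ℂ] UEA n)
    (hδ : ∀ x y, δ (x * y) = δ x * y + x * δ y) (hδe : ∀ i j r, δ (eGen n i j r) = 0) {x : UEA n}
    (hx : x ∈ Uneg n) : δ x = 0 := by
  have hδ1 : δ 1 = 0 := by simpa using hδ 1 1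
  induction hx using Algebra.adjoin_induction with
  | mem x hx =>
    obtain ⟨i, j, r, -, rfl⟩ := hx
    exact hδe i j r
  | algebraMap c => rw [Algebra.algebraMap_eq_smul_one, map_smul, hδ1, smul_zero]
  | add x y _ _ hx hy => rw [map_add, hx, hy, add_zero]
  | mul x y _ _ hx hy => rw [hδ, hx, hy, zero_mul, mul_zero, add_zero]

end AffineSystem

/-- for `k ≥ 0` write `tr (τ + E[-1])^k = T_{k0} τ^k + T_{k1} τ^{k-1}
+ ⋯ + T_{kk}` with powers of `τ` on the right and coefficients `T_{kl} ∈ U(g₋)`.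
Then every `T_{kl}` is a Segal–Sugawara vector: `e_{ij}[r] · T_{kl} ∈ (K+n)·U + I`
for every `r ≥ 0`.  Here `l : Fin (k+1)` corresponds to `T_{kl}`, which is the
coefficient of `τ^{k-l}`. -/
theorem trace_coeffs_are_segal_sugawara (n : ℕ) (hn : 1 ≤ n) (k : ℕ)
    (T : Fin (k + 1) → UEA n) (hT : ∀ l, T l ∈ Uneg n)
    (hdef : Matrix.trace (tauE n ^ k)
      = ∑ l : Fin (k + 1), T l * tauGen n ^ (k - (l : ℕ))) :
    ∀ (l : Fin (k + 1)) (i j : Fin n) (r : ℤ), 0 ≤ r →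
      eGen n i j r * T l ∈ KnI n := by
  intro l i j r hr
  obtain ⟨δ, hδ, hδe, hδτ⟩ := AffineSystem.exists_derivation n
  have hsum : Matrix.trace ((AffineSystem.ofUEA n).M ^ k) = ∑ l ∈ Finset.range (k + 1),
      (if h : l < k + 1 then T ⟨l, h⟩ else 0) * tauGen n ^ (k - l) := by
    rw [Finset.sum_range]
    simpa only [Fin.is_lt, dite_true] using! hdef
  have := (AffineSystem.ofUEA n).mul_coeff_mem δ hδ hδe hδτ (eGen n i j r)
    (fun k => (AffineSystem.ofUEA n).e_mul_trace_mem hn k i j hr) k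
    (fun l => if h : l < k + 1 then T ⟨l, h⟩ else 0)
    (fun l => by
      split_ifs
      · exact AffineSystem.derivation_eq_zero_of_mem_Uneg δ hδ hδe (hT _)
      · exact map_zero δ)
    hsum l (Nat.lt_succ_iff.mp l.2)
  simp only [Fin.is_lt, dite_true] at this
  exact this
end

section
/- Let A = [a_{ij}] be an n×n matrix with entries in a ring (not necessarily commutative), let b be an element of the ring, and fix indices 1 ≤ i, j ≤ n. Let A' be the matrix obtained from A by replacing column j with the column whose entries are all zero except for the i-th entry, which equals b. Then cdet A' = (−1)^{n−j} cdet C + (−1)^{i+j} Σ_{k=j+1}^n cdet B_k, where: C is the n×n matrix whose first n−1 columns are columns 1, …, j−1, j+1, …, n of A in that order and whose last column has all entries zero except the i-th entry equal to b; and for each k with j < k ≤ n, B_k is the (n−1)×(n−1) matrix obtained from A by deleting row i and column j and then replacing each remaining entry a_{mk} of original column k (which is column k−1 of the smaller matrix) by the commutator [b, a_{mk}] = b a_{mk} − a_{mk} b. -/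
open scoped BigOperators

theorem prod_mul_commutator_expansion {R : Type*} [Ring R] (b : R) {n : ℕ} (g : Fin n → R) :
    b * (List.ofFn g).prod = (List.ofFn g).prod * b +
      ∑ k, (List.ofFn fun c => if c = k then b * g c - g c * b else g c).prod := by
  induction n with
  | zero => simp
  | succ n ih =>
    have h := ih fun c => g c.succ
    have hz (k : Fin n) : (0 : Fin (n + 1)) ≠ k.succ := (Fin.succ_ne_zero k).symm
    simp only [List.ofFn_succ, List.prod_cons, Fin.sum_univ_succ, Fin.succ_inj, hz,
      Fin.succ_ne_zero, if_true, if_false]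
    rw [← Finset.mul_sum, mul_assoc, sub_mul, mul_assoc (g 0) b, h]
    noncomm_ring

theorem prod_insertNth_commutator_expansion {R : Type*} [Ring R] (b : R) {n : ℕ}
    (g : Fin n → R) (j : Fin (n + 1)) :
    (List.ofFn (j.insertNth b g : Fin (n + 1) → R)).prod = (List.ofFn g).prod * b +
      ∑ k ∈ Finset.Ioi j,
        (List.ofFn fun c => if j.succAbove c = k then b * g c - g c * b else g c).prod := by
  induction n with
  | zero =>
    obtain rfl : j = 0 := Fin.fin_one_eq_zero j
    simp
  | succ n ih =>
    cases j using Fin.cases with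
    | zero =>
      have h := prod_mul_commutator_expansion b g
      rw [Fin.Ioi_zero_eq_map, Finset.sum_map]
      simpa [List.ofFn_succ (f := Fin.cons b g)] using h
    | succ j =>
      have h := ih (fun c => g c.succ) j
      have hz (k : Fin (n + 1)) : (0 : Fin (n + 2)) ≠ k.succ := (Fin.succ_ne_zero k).symm
      have hi : (fun c : Fin (n + 1) => (j.succ.insertNth b g : Fin (n + 2) → R) c.succ) =
          j.insertNth b (fun c => g c.succ) := by
        rw [Fin.eq_insertNth_iff]
        refine ⟨by simp, ?_⟩
        ext c
        simp only [Fin.removeNth]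
        rw [← Fin.succ_succAbove_succ, Fin.insertNth_apply_succAbove]
      have h0 : (j.succ.insertNth b g : Fin (n + 2) → R) 0 = g 0 := by
        rw [← Fin.succ_succAbove_zero j, Fin.insertNth_apply_succAbove]
      rw [List.ofFn_succ, List.prod_cons, hi, h0, h, ← Fin.map_succEmb_Ioi, Finset.sum_map]
      simp [List.ofFn_succ, hz, ← Finset.mul_sum, mul_add, mul_assoc]

theorem cdet_eq_sum_of_column {R : Type*} [Ring R] {n : ℕ}
    (M : Matrix (Fin (n + 1)) (Fin (n + 1)) R) (i j : Fin (n + 1))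
    (hM : ∀ m, m ≠ i → M m j = 0) :
    cdet M = (-1 : R) ^ ((i : ℕ) + (j : ℕ)) * ∑ σ : Equiv.Perm (Fin n),
      (Equiv.Perm.sign σ : ℤ) • (List.ofFn (j.insertNth (M i j)
        fun c => M (i.succAbove (σ c)) (j.succAbove c) : Fin (n + 1) → R)).prod := by
  let e : Fin (n + 1) × Equiv.Perm (Fin n) ≃ Equiv.Perm (Fin (n + 1)) :=
    Equiv.Perm.decomposeFin.symm.trans
      ((Equiv.mulRight j.cycleRange).trans (Equiv.mulLeft i.cycleRange.symm))
  have he (p σ x) : e (p, σ) x =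
    i.cycleRange.symm (Equiv.Perm.decomposeFin.symm (p, σ) (j.cycleRange x)) := rfl
  have hs (σ) : (Equiv.Perm.sign (e (0, σ))) = (-1) ^ ((i : ℕ) + j) * Equiv.Perm.sign σ := by
    change Equiv.Perm.sign (i.cycleRange.symm *
      (Equiv.Perm.decomposeFin.symm (0, σ) * j.cycleRange)) = _
    simp only [map_mul, Equiv.Perm.sign_symm, Fin.sign_cycleRange,
      Equiv.Perm.decomposeFin.symm_sign, if_true, one_mul]
    rw [pow_add, mul_assoc, mul_comm (Equiv.Perm.sign σ)]
  rw [cdet, ← e.sum_comp, Fintype.sum_prod_type, Finset.sum_eq_single 0, Finset.mul_sum]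
  · refine Finset.sum_congr rfl fun σ _ => ?_
    have hf : (fun x => M (e (0, σ) x) x) =
        j.insertNth (M i j) fun c => M (i.succAbove (σ c)) (j.succAbove c) := by
      rw [Fin.eq_insertNth_iff]
      refine ⟨by simp [he], ?_⟩
      ext c
      simp [he, Fin.removeNth]
    rw [hf, hs]
    simp [mul_smul, zsmul_eq_mul]
  · intro p _ hp
    refine Finset.sum_eq_zero fun σ _ => ?_
    rw [List.prod_eq_zero, smul_zero]
    rw [List.mem_ofFn]
    refine ⟨j, hM _ fun h => hp ?_⟩
    rw [he] at h
    simpa [Equiv.symm_apply_eq] using h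
  · simp


/-- Lemma on a column with a single entry `b`.  The matrix size is
`n + 1` (so indices are 0-based and the paper's `n` is `n + 1`); `A'` replaces
column `j` of `A` by the column with single entry `b` in row `i`; `C` moves
column `j` to the last position (its first `n` columns are the columns of `A`
other than `j`, in order, and its last column has single entry `b` in row `i`);
`B_k` (for `k > j`) deletes row `i` and column `j` of `A` and replaces the
entries of original column `k` by the commutators `[b, a_{mk}]`.  Then
`cdet A' = (-1)^{n-j} cdet C + (-1)^{i+j} Σ_{k>j} cdet B_k`. -/
theorem cdet_single_entry_column {R : Type*} [Ring R] {n : ℕ}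
    (A : Matrix (Fin (n + 1)) (Fin (n + 1)) R) (b : R) (i j : Fin (n + 1)) :
    cdet (Matrix.of fun m k =>
        if k = j then (if m = i then b else 0) else A m k)
      = (-1 : R) ^ (n - (j : ℕ)) *
          cdet (Matrix.of fun m k : Fin (n + 1) =>
            if h : (k : ℕ) < n then A m (j.succAbove ⟨(k : ℕ), h⟩)
            else (if m = i then b else 0))
        + (-1 : R) ^ ((i : ℕ) + (j : ℕ)) *
          ∑ k ∈ Finset.Ioi j,
            cdet (Matrix.of fun m' c' : Fin n =>
              if j.succAbove c' = k then
                b * A (i.succAbove m') k - A (i.succAbove m') k * b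
              else A (i.succAbove m') (j.succAbove c')) := by
  rw [cdet_eq_sum_of_column _ i j (by intro m hm; simp [hm]),
    cdet_eq_sum_of_column _ i (Fin.last n) (by intro m hm; simp [hm]), ← mul_assoc, ← pow_add]
  have hp : (-1 : R) ^ (n - (j : ℕ) + ((i : ℕ) + (Fin.last n : ℕ))) =
      (-1) ^ ((i : ℕ) + (j : ℕ)) := by
    have hj : n - (j : ℕ) + ((i : ℕ) + (Fin.last n : ℕ)) =
        (i : ℕ) + (j : ℕ) + 2 * (n - (j : ℕ)) := by
      have := j.is_le
      simp only [Fin.val_last]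
      omega
    rw [hj, pow_add, pow_mul]
    simp
  rw [hp, ← mul_add]
  congr 1
  simp only [cdet]
  rw [Finset.sum_comm, ← Finset.sum_add_distrib]
  refine Finset.sum_congr rfl fun σ _ => ?_
  rw [← Finset.smul_sum, ← smul_add]
  congr 1
  simp only [prod_insertNth_commutator_expansion, Matrix.of_apply]
  have hl : Finset.Ioi (Fin.last n) = ∅ := Finset.Ioi_eq_empty.2 fun x _ => x.le_last
  simp only [hl, Finset.sum_empty, add_zero]
  simp only [Fin.succAbove_ne, Fin.succAbove_last, Fin.val_castSucc, Fin.is_lt, Fin.eta,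
    dite_true, Fin.val_last, lt_irrefl, dite_false, if_true, if_false]
  congr 1
  refine Finset.sum_congr rfl fun k _ => ?_
  congr! 3 with c
  split_ifs with h
  · rw [h]
  · rfl
end

section
/- Let A be an n×n Manin matrix with entries in an associative unital algebra over ℂ, and let A' be the matrix obtained from A by interchanging two distinct columns. Then cdet A' = −cdet A. -/
open scoped BigOperators

/-- A square matrix `A = [a_{ij}]` with entries in a ring is a Manin matrix if
`a_{ij} a_{kl} - a_{kl} a_{ij} = a_{kj} a_{il} - a_{il} a_{kj}` for all
`i, j, k, l`. -/
def IsManin {R : Type*} [Ring R] {n : ℕ} (A : Matrix (Fin n) (Fin n) R) : Prop :=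
  ∀ i j k l : Fin n, A i j * A k l - A k l * A i j = A k j * A i l - A i l * A k j
/-- An ordered product is the product of two adjacent factors between a left and a right
part that depend only on the remaining factors. -/
theorem exists_prod_ofFn_eq_mul_adjacent {M : Type*} [Monoid M] :
    ∀ {m : ℕ} (f : Fin (m + 1) → M) (i : Fin m),
      ∃ u v : M, ∀ g : Fin (m + 1) → M, (∀ j, j ≠ i.castSucc → j ≠ i.succ → g j = f j) →
        (List.ofFn g).prod = u * (g i.castSucc * g i.succ) * v
  | 0, _, i => i.elim0
  | m + 1, f, i => by
    induction i using Fin.cases with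
    | zero =>
      refine ⟨1, (List.ofFn fun j : Fin m => f j.succ.succ).prod, fun g hg => ?_⟩
      have h : (fun j : Fin m => g j.succ.succ) = fun j => f j.succ.succ := by
        funext j
        exact hg _ (Fin.succ_ne_zero _) fun h => Fin.succ_ne_zero j (Fin.succ_injective _ h)
      rw [List.ofFn_succ, List.ofFn_succ, h]
      simp [mul_assoc]
    | succ k =>
      obtain ⟨u, v, huv⟩ := exists_prod_ofFn_eq_mul_adjacent (fun j => f j.succ) k
      refine ⟨f 0 * u, v, fun g hg => ?_⟩
      have h₀ : g 0 = f 0 := hg 0 (by simp [Fin.ext_iff]) (by simp [Fin.ext_iff])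
      have h := huv (fun j => g j.succ) fun j h₁ h₂ =>
        hg _ (fun h => h₁ (Fin.succ_injective _ h)) fun h => h₂ (Fin.succ_injective _ h)
      rw [List.ofFn_succ, List.prod_cons, h, h₀]
      simp [mul_assoc]

theorem IsManin.submatrix_id {R : Type*} [Ring R] {n : ℕ} {A : Matrix (Fin n) (Fin n) R}
    (hA : IsManin A) (f : Fin n → Fin n) : IsManin (A.submatrix id f) :=
  fun i j k l => hA i (f j) k (f l)

theorem IsManin.cdet_swap_adjacent {R : Type*} [Ring R] {m : ℕ}
    {A : Matrix (Fin (m + 1)) (Fin (m + 1)) R} (hA : IsManin A) (i : Fin m) :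
    cdet (A.submatrix id (Equiv.swap i.castSucc i.succ)) = - cdet A := by
  have hne : i.castSucc ≠ i.succ := Fin.castSucc_lt_succ.ne
  rw [eq_neg_iff_add_eq_zero]
  unfold cdet
  rw [← Finset.sum_add_distrib]
  refine Finset.sum_involution (fun σ _ => σ * Equiv.swap i.castSucc i.succ) ?_ ?_
    (fun _ _ => Finset.mem_univ _) (fun σ _ => by simp [mul_assoc])
  · intro σ _
    obtain ⟨u, v, huv⟩ := exists_prod_ofFn_eq_mul_adjacent (fun j => A (σ j) j) i
    rw [huv (fun j => A.submatrix id (Equiv.swap i.castSucc i.succ) (σ j) j)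
        (fun j h₁ h₂ => by simp [Equiv.swap_apply_of_ne_of_ne h₁ h₂]),
      huv (fun j => A (σ j) j) (fun _ _ _ => rfl),
      huv (fun j => A.submatrix id (Equiv.swap i.castSucc i.succ)
          ((σ * Equiv.swap i.castSucc i.succ) j) j)
        (fun j h₁ h₂ => by simp [Equiv.swap_apply_of_ne_of_ne h₁ h₂]),
      huv (fun j => A ((σ * Equiv.swap i.castSucc i.succ) j) j)
        (fun j h₁ h₂ => by simp [Equiv.swap_apply_of_ne_of_ne h₁ h₂])]
    have h := congrArg (fun x => u * x * v)
      (hA (σ i.castSucc) i.castSucc (σ i.succ) i.succ)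
    simp only [mul_sub, sub_mul] at h
    simp only [Equiv.Perm.sign_mul, Equiv.Perm.sign_swap hne, Matrix.submatrix_apply, id,
      Equiv.Perm.mul_apply, Equiv.swap_apply_left, Equiv.swap_apply_right, mul_neg, mul_one,
      Units.val_neg, neg_smul, ← smul_add, ← smul_neg]
    convert smul_zero (Equiv.Perm.sign σ : ℤ) using 2
    rw [← sub_eq_zero] at h
    rw [← h]
    abel
  · intro σ _ _ h
    exact hne (Equiv.swap_eq_one_iff.mp (mul_eq_left.mp h))

theorem IsManin.cdet_submatrix_perm {R : Type*} [Ring R] {n : ℕ}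
    {A : Matrix (Fin n) (Fin n) R} (hA : IsManin A) (π : Equiv.Perm (Fin n)) :
    cdet (A.submatrix id π) = (Equiv.Perm.sign π : ℤ) • cdet A := by
  cases n with
  | zero => simp [Subsingleton.elim π 1]
  | succ m =>
    have hπ : π ∈ Submonoid.closure
        (Set.range fun i : Fin m => Equiv.swap i.castSucc i.succ) := by
      rw [Equiv.Perm.mclosure_swap_castSucc_succ]
      exact Submonoid.mem_top π
    induction hπ using Submonoid.closure_induction_right with
    | one => simp
    | mul_right ρ _ τ hτ ih =>
      obtain ⟨i, rfl⟩ := hτ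
      have h := (hA.submatrix_id ρ).cdet_swap_adjacent i
      rw [Matrix.submatrix_submatrix] at h
      rw [Equiv.Perm.coe_mul]
      refine h.trans ?_
      rw [ih, Equiv.Perm.sign_mul, Equiv.Perm.sign_swap Fin.castSucc_lt_succ.ne]
      simp

/-- interchanging two distinct columns of a Manin matrix with
entries in an associative unital algebra over ℂ changes the sign of the
column-determinant. -/
theorem cdet_column_swap_manin {R : Type*} [Ring R] [Algebra ℂ R] {n : ℕ}
    (A : Matrix (Fin n) (Fin n) R) (hA : IsManin A)
    (p q : Fin n) (hpq : p ≠ q) :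
    cdet (A.submatrix id (⇑(Equiv.swap p q))) = - cdet A := by
  simpa [Equiv.Perm.sign_swap hpq] using hA.cdet_submatrix_perm (Equiv.swap p q)
end

section
/- Let R be an associative unital ring containing elements τ and x_{ij}, y_{ij} for 1 ≤ i, j ≤ n such that [τ, x_{ij}] = y_{ij} and [x_{ij}, x_{kl}] = δ_{kj} y_{il} − δ_{il} y_{kj} for all i, j, k, l (where [a,b] = ab − ba and δ is the Kronecker delta). Then the n×n matrix M with entries M_{ij} = δ_{ij} τ + x_{ij} is a Manin matrix. In particular, in the universal enveloping algebra U of the Lie algebra L (taking τ = τ, x_{ij} = e_{ij}[−1], y_{ij} = e_{ij}[−2]), the matrix τ + E[−1] with (i,j) entry δ_{ij} τ + e_{ij}[−1] is a Manin matrix. -/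
open scoped BigOperators

/-- The commutator of two entries of `δ_{ij} t + x_{ij}`. -/
theorem commutator_diagonal_add {R : Type*} [Ring R] {n : ℕ} (t : R) (x y : Fin n → Fin n → R)
    (ht : ∀ i j, t * x i j - x i j * t = y i j)
    (hx : ∀ i j k l, x i j * x k l - x k l * x i j
      = (if k = j then y i l else 0) - (if i = l then y k j else 0)) (i j k l : Fin n) :
    ((if i = j then t else 0) + x i j) * ((if k = l then t else 0) + x k l)
        - ((if k = l then t else 0) + x k l) * ((if i = j then t else 0) + x i j)
      = (if i = j then y k l else 0) - (if k = l then y i j else 0)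
        + ((if k = j then y i l else 0) - (if i = l then y k j else 0)) := by
  rw [← hx i j k l, ← ht i j, ← ht k l]
  split_ifs <;> noncomm_ring

theorem isManin_diagonal_add {R : Type*} [Ring R] {n : ℕ} (t : R) (x y : Fin n → Fin n → R)
    (ht : ∀ i j, t * x i j - x i j * t = y i j)
    (hx : ∀ i j k l, x i j * x k l - x k l * x i j
      = (if k = j then y i l else 0) - (if i = l then y k j else 0)) :
    IsManin (Matrix.of fun i j => (if i = j then t else 0) + x i j) := by
  intro i j k l
  simp only [Matrix.of_apply]
  rw [commutator_diagonal_add t x y ht hx i j k l, commutator_diagonal_add t x y ht hx k j i l]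
  abel

theorem tauGen_commutator_eGen (n : ℕ) (i j : Fin n) (r : ℤ) :
    tauGen n * eGen n i j r - eGen n i j r * tauGen n = (-r : ℂ) • eGen n i j (r - 1) := by
  simpa only [tauGen, eGen, map_sub, map_mul, map_smul] using
    RingQuot.mkAlgHom_rel ℂ (AffRel.TE i j r)

theorem eGen_commutator_eGen (n : ℕ) (i j k l : Fin n) (r s : ℤ) (hrs : r ≠ -s) :
    eGen n i j r * eGen n k l s - eGen n k l s * eGen n i j r
      = (if k = j then eGen n i l (r + s) else 0)
        - (if i = l then eGen n k j (r + s) else 0) := by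
  have h := RingQuot.mkAlgHom_rel ℂ (AffRel.EE i j k l r s)
  simpa only [eGen, map_sub, map_mul, map_add, map_smul, apply_ite (RingQuot.mkAlgHom ℂ (AffRel n)),
    map_zero, if_neg hrs, mul_zero, zero_mul, zero_smul, add_zero] using h

/-- if a ring `R` contains elements `τ`, `x_{ij}`, `y_{ij}` with
`[τ, x_{ij}] = y_{ij}` and `[x_{ij}, x_{kl}] = δ_{kj} y_{il} - δ_{il} y_{kj}`,
then the matrix `M` with `M_{ij} = δ_{ij} τ + x_{ij}` is a Manin matrix.
In particular, in the universal enveloping algebra `U` of `L` the matrix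
`τ + E[-1]` is a Manin matrix. -/
theorem tau_plus_x_is_manin (n : ℕ) (hn : 1 ≤ n) :
    (∀ (R : Type) [Ring R], ∀ (t : R) (x y : Fin n → Fin n → R),
      (∀ i j, t * x i j - x i j * t = y i j) →
      (∀ i j k l, x i j * x k l - x k l * x i j
        = (if k = j then y i l else 0) - (if i = l then y k j else 0)) →
      IsManin (Matrix.of fun i j => (if i = j then t else 0) + x i j))
    ∧ IsManin (tauE n) := by
  refine ⟨fun R _ t x y => isManin_diagonal_add t x y,
    isManin_diagonal_add (tauGen n) (fun i j => eGen n i j (-1)) (fun i j => eGen n i j (-2))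
      (fun i j => ?_) (fun i j k l => ?_)⟩
  · simpa using tauGen_commutator_eGen n i j (-1)
  · exact eGen_commutator_eGen n i j k l (-1) (-1) (by decide)
end
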